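/- arXiv:0706.2552 — 2 statements merged into one kernel-verified Lean document; each statement's English description precedes it below -/
import Mathlib

section
/- Let σ and τ be classical symbols with constant coefficients on ℝⁿ (n ≥ 2) and suppose σ ∼ ∂_{ξ_i}τ for some i ∈ {1,…,n}, i.e. σ − ∂_{ξ_i}τ is a smoothing symbol. Then res(σ) = 0. In other words, the noncommutative residue vanishes on symbols which are partial derivatives up to a smoothing symbol (Stokes' property for the residue). -/
open MeasureTheory Metric Filter Complex
open scoped Topology RealInnerProductSpace Classical

noncomputable section

/-- ℝⁿ with the euclidean norm. -/
abbrev Euc (n : ℕ) := EuclideanSpace ℝ (Fin n)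

/-- Partial derivative in the `i`-th coordinate direction. -/
def pd {n : ℕ} (i : Fin n) (f : Euc n → ℂ) : Euc n → ℂ :=
  fun ξ => fderiv ℝ f ξ (EuclideanSpace.single i 1)

/-- Iterated partial derivatives along a list of coordinate directions
(a multi-index `β` corresponds to the lists containing `i` exactly `β i` times). -/
def pdIter {n : ℕ} : List (Fin n) → (Euc n → ℂ) → (Euc n → ℂ)
  | [], f => f
  | i :: L, f => pd i (pdIter L f)

/-- A smooth cut-off function vanishing near `0` and equal to `1` outside the unit ball. -/
structure IsCutoff {n : ℕ} (χ : Euc n → ℝ) : Prop where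
  smooth : ContDiff ℝ (⊤ : ℕ∞) χ
  zero_near : ∃ ε > (0:ℝ), ∀ ξ : Euc n, ‖ξ‖ < ε → χ ξ = 0
  one_far : ∀ ξ : Euc n, 1 ≤ ‖ξ‖ → χ ξ = 1

/-- `σ` is a classical symbol of order `a` with constant coefficients on `ℝⁿ`, with
homogeneous components `σc j` of degree `a - j`. -/
structure IsCS {n : ℕ} (χ : Euc n → ℝ) (a : ℂ) (σ : Euc n → ℂ)
    (σc : ℕ → Euc n → ℂ) : Prop where
  smooth : ContDiff ℝ (⊤ : ℕ∞) σ
  comp_smooth : ∀ j, ContDiffOn ℝ (⊤ : ℕ∞) (σc j) {(0 : Euc n)}ᶜ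
  comp_homog : ∀ (j : ℕ) (t : ℝ), 0 < t → ∀ ξ : Euc n, ξ ≠ 0 →
    σc j (t • ξ) = (t : ℂ) ^ (a - j) * σc j ξ
  estimate : ∀ (N : ℕ) (L : List (Fin n)), ∃ C > (0:ℝ), ∀ ξ : Euc n,
    ‖pdIter L (fun η => σ η - ∑ j ∈ Finset.range N, (χ η : ℂ) * σc j η) ξ‖ ≤
      C * (1 + ‖ξ‖) ^ (a.re - N - L.length : ℝ)

/-- A smoothing symbol with constant coefficients on `ℝⁿ`. -/
def IsSmoothing {n : ℕ} (σ : Euc n → ℂ) : Prop :=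
  ContDiff ℝ (⊤ : ℕ∞) σ ∧
    ∀ (L : List (Fin n)) (M : ℝ), 0 < M → ∃ C > (0:ℝ), ∀ ξ : Euc n,
      ‖pdIter L σ ξ‖ ≤ C * (1 + ‖ξ‖) ^ (-M)

/-- The surface measure on the unit sphere `S^{n-1} ⊂ ℝⁿ`. -/
def sphMeas (n : ℕ) : Measure (sphere (0 : Euc n) 1) :=
  (volume : Measure (Euc n)).toSphere

/-- The integral of a homogeneous component over the unit sphere. -/
def sphInt {n : ℕ} (f : Euc n → ℂ) : ℂ :=
  ∫ ω : sphere (0 : Euc n) 1, f ↑ω ∂(sphMeas n)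

/-- The noncommutative residue of a classical symbol of order `a` with homogeneous
components `σc j` of degree `a - j`. -/
def resCC {n : ℕ} (a : ℂ) (σc : ℕ → Euc n → ℂ) : ℂ :=
  if h : ∃ j : ℕ, a - j = -(n : ℂ) then
    (((2 * Real.pi) ^ (-(n : ℝ) / 2) : ℝ) : ℂ) * sphInt (σc h.choose)
  else 0

/-- The cut-off regularised integral of a classical symbol of order `a` with homogeneous
components `σc`, computed with an integer `N` such that `Re a - N < -n`. -/
def cutoffInt {n : ℕ} (χ : Euc n → ℝ) (a : ℂ) (σ : Euc n → ℂ)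
    (σc : ℕ → Euc n → ℂ) (N : ℕ) : ℂ :=
  (∫ ξ : Euc n, (σ ξ - ∑ j ∈ Finset.range N, (χ ξ : ℂ) * σc j ξ))
  + ∑ j ∈ Finset.range N, ∫ ξ in Metric.ball (0 : Euc n) 1, (χ ξ : ℂ) * σc j ξ
  - ∑ j ∈ Finset.range N,
      if a - j + n ≠ 0 then (a - j + n)⁻¹ * sphInt (σc j) else 0


lemma exists_pos_cpow_ne_one {e : ℂ} (he : e ≠ 0) : ∃ l : ℝ, 0 < l ∧ (l : ℂ) ^ e ≠ 1 := by
  by_contra! hcon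
  have hconst : (fun t : ℝ => Complex.exp (t * e)) = fun _ => 1 := by
    funext t
    have := hcon (Real.exp t) (Real.exp_pos t)
    rwa [Complex.cpow_def_of_ne_zero (by simp), ← Complex.ofReal_log
      (Real.exp_pos t).le, Real.log_exp] at this
  have hd : HasDerivAt (fun t : ℝ => Complex.exp (t * e)) (Complex.exp ((0 : ℝ) * e) * (1 * e)) 0 :=
    ((Complex.ofRealCLM.hasDerivAt (x := (0 : ℝ))).mul_const e).cexp
  rw [hconst] at hd
  have := hd.unique (hasDerivAt_const (0 : ℝ) (1 : ℂ))
  exact he (by simpa using this)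

/-- Nonzero powers of `R` cannot compensate a nonzero constant as `R → ∞`. -/
lemma eq_zero_of_tendsto_add_sum_cpow {ι : Type*} (S : Finset ι) (e : ι → ℂ)
    (he : ∀ s ∈ S, e s ≠ 0) (c : ι → ℂ) (c₀ : ℂ)
    (h : Tendsto (fun R : ℝ => c₀ + ∑ s ∈ S, c s * (R : ℂ) ^ e s) atTop (𝓝 0)) : c₀ = 0 := by
  induction S using Finset.induction_on generalizing c c₀ with
  | empty => simpa using h
  | insert s S hs ih =>
    obtain ⟨l, hl, hl1⟩ := exists_pos_cpow_ne_one (he s (Finset.mem_insert_self s S))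
    have hscale := h.comp (tendsto_id.const_mul_atTop hl)
    have hdiff := hscale.sub (h.const_mul ((l : ℂ) ^ e s))
    have hzero : c₀ * (1 - (l : ℂ) ^ e s) = 0 := by
      refine ih (fun x hx => he x (Finset.mem_insert_of_mem hx))
        (fun x => c x * ((l : ℂ) ^ e x - (l : ℂ) ^ e s)) _ ?_
      rw [mul_zero, sub_zero] at hdiff
      refine hdiff.congr' ?_
      filter_upwards [eventually_ge_atTop 0] with R hR
      simp only [Function.comp_apply, id_eq, Finset.sum_insert hs, Complex.ofReal_mul,
        Complex.mul_cpow_ofReal_nonneg hl.le hR]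
      have hsum : ∑ x ∈ S, c x * ((l : ℂ) ^ e x - (l : ℂ) ^ e s) * (R : ℂ) ^ e x
          = ∑ x ∈ S, c x * ((l : ℂ) ^ e x * (R : ℂ) ^ e x)
            - (l : ℂ) ^ e s * ∑ x ∈ S, c x * (R : ℂ) ^ e x := by
        rw [Finset.mul_sum, ← Finset.sum_sub_distrib]
        exact Finset.sum_congr rfl fun x _ => by ring
      rw [hsum]
      ring
    exact (mul_eq_zero.mp hzero).resolve_right (sub_ne_zero.mpr hl1.symm)

/-- If a finite sum of complex powers of `R` tends to `0`, the coefficients of `R ^ 0` add up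
to zero. -/
lemma sum_filter_eq_zero_of_tendsto_sum_cpow {ι : Type*} (S : Finset ι) (e c : ι → ℂ)
    (h : Tendsto (fun R : ℝ => ∑ s ∈ S, c s * (R : ℂ) ^ e s) atTop (𝓝 0)) :
    ∑ s ∈ S with e s = 0, c s = 0 := by
  refine eq_zero_of_tendsto_add_sum_cpow (S.filter fun s => ¬ e s = 0) e
    (fun s hs => (Finset.mem_filter.mp hs).2) c _ (h.congr fun R => ?_)
  rw [← Finset.sum_filter_add_sum_filter_not S (fun s => e s = 0)]
  congr 1
  exact Finset.sum_congr rfl fun s hs => by simp [(Finset.mem_filter.mp hs).2]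

/-- Integration in polar coordinates of a product of a radial and an angular function. -/
lemma integral_radial_mul_angular {n : ℕ} (hn : n ≠ 0) (f : ℝ → ℂ) (u : Euc n → ℂ) :
    ∫ ξ : Euc n, f ‖ξ‖ * u (‖ξ‖⁻¹ • ξ)
      = sphInt u * ∫ r in Set.Ioi (0 : ℝ), ((r : ℂ) ^ (n - 1)) * f r := by
  have hdim : Module.finrank ℝ (Euc n) = n := by simp
  have : Nontrivial (Euc n) := Module.nontrivial_of_finrank_pos (R := ℝ) (by omega)
  calc
    ∫ ξ : Euc n, f ‖ξ‖ * u (‖ξ‖⁻¹ • ξ)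
      = ∫ x : ({(0 : Euc n)}ᶜ : Set (Euc n)), f ‖x.1‖ * u (‖x.1‖⁻¹ • x.1)
          ∂((volume : Measure (Euc n)).comap Subtype.val) := by
      rw [integral_subtype_comap (measurableSet_singleton _).compl
        fun x : Euc n => f ‖x‖ * u (‖x‖⁻¹ • x), restrict_compl_singleton]
    _ = ∫ x : sphere (0 : Euc n) 1 × Set.Ioi (0 : ℝ), u x.1 * f x.2
          ∂(volume : Measure (Euc n)).toSphere.prod (.volumeIoiPow (n - 1)) := by
      have := (volume : Measure (Euc n)).measurePreserving_homeomorphUnitSphereProd.integral_comp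
        (Homeomorph.measurableEmbedding _)
        (fun x : sphere (0 : Euc n) 1 × Set.Ioi (0 : ℝ) => u x.1 * f x.2)
      rw [hdim] at this
      rw [← this]
      simp [mul_comm]
    _ = sphInt u * ∫ r : Set.Ioi (0 : ℝ), f r ∂.volumeIoiPow (n - 1) :=
      integral_prod_mul (fun ω : sphere (0 : Euc n) 1 => u ω) (fun r : Set.Ioi (0 : ℝ) => f r)
    _ = _ := by
      congr 1
      simp only [Measure.volumeIoiPow, ENNReal.ofReal]
      rw [integral_withDensity_eq_integral_smul
          ((measurable_subtype_coe.pow_const _).real_toNNReal),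
        integral_subtype_comap measurableSet_Ioi fun r : ℝ => Real.toNNReal (r ^ (n - 1)) • f r]
      refine setIntegral_congr_fun measurableSet_Ioi fun r hr => ?_
      simp only [NNReal.smul_def, Real.coe_toNNReal _ (pow_nonneg (le_of_lt hr) _)]
      simp

/-- Continuous compactly supported functions vanishing on the open unit ball. -/
structure IsAnnular {n : ℕ} (φ : Euc n → ℂ) : Prop where
  continuous : Continuous φ
  hasCompactSupport : HasCompactSupport φ
  eq_zero : ∀ ξ, ‖ξ‖ < 1 → φ ξ = 0

lemma IsAnnular.integrable_mul {n : ℕ} {φ : Euc n → ℂ} (hφ : IsAnnular φ) {f : Euc n → ℂ}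
    (hf : ContinuousOn f {0}ᶜ) : Integrable fun ξ => f ξ * φ ξ := by
  refine Continuous.integrable_of_hasCompactSupport ?_ hφ.hasCompactSupport.mul_left
  rw [continuous_iff_continuousAt]
  intro ξ
  by_cases hξ : ξ = 0
  · subst hξ
    refine (continuousAt_const (y := (0 : ℂ))).congr ?_
    filter_upwards [ball_mem_nhds (0 : Euc n) one_pos] with η hη
    rw [hφ.eq_zero η (by simpa using hη), mul_zero]
  · exact (hf.continuousAt (isOpen_compl_singleton.mem_nhds hξ)).mul hφ.continuous.continuousAt

lemma IsAnnular.tendsto_pow_mul_integral {n : ℕ} {φ f : Euc n → ℂ} (hφ : IsAnnular φ)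
    {m : ℕ} {p C : ℝ} (hmp : m + p < 0)
    (hf : ∀ ξ, ‖f ξ‖ ≤ C * (1 + ‖ξ‖) ^ p) :
    Tendsto (fun R : ℝ => (R : ℂ) ^ m * ∫ ξ, f (R • ξ) * φ ξ) atTop (𝓝 0) := by
  have hp : p ≤ 0 := by
    have : (0 : ℝ) ≤ m := m.cast_nonneg
    linarith
  have hC : 0 ≤ C := by simpa using (norm_nonneg _).trans (hf 0)
  have hlim : Tendsto (fun R : ℝ => R ^ (m + p) * (C * ∫ ξ, ‖φ ξ‖)) atTop (𝓝 0) := by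
    have := (tendsto_rpow_neg_atTop (y := -(m + p)) (by linarith)).mul_const (C * ∫ ξ, ‖φ ξ‖)
    simpa only [neg_neg, zero_mul] using this
  refine squeeze_zero_norm' ?_ hlim
  filter_upwards [eventually_ge_atTop 1] with R hR
  have hR0 : 0 < R := by linarith
  have hint : ‖∫ ξ, f (R • ξ) * φ ξ‖ ≤ ∫ ξ, C * R ^ p * ‖φ ξ‖ := by
    refine norm_integral_le_of_norm_le
      ((hφ.continuous.integrable_of_hasCompactSupport hφ.hasCompactSupport).norm.const_mul _)
      (Eventually.of_forall fun ξ => ?_)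
    rw [norm_mul]
    rcases lt_or_ge ‖ξ‖ 1 with hξ | hξ
    · simp [hφ.eq_zero ξ hξ]
    · gcongr
      refine (hf _).trans ?_
      gcongr C * ?_
      refine Real.rpow_le_rpow_of_nonpos hR0 ?_ hp
      rw [norm_smul, Real.norm_of_nonneg hR0.le]
      nlinarith
  rw [norm_mul, norm_pow, Complex.norm_real, Real.norm_of_nonneg hR0.le, Real.rpow_add hR0,
    Real.rpow_natCast]
  calc R ^ m * ‖∫ ξ, f (R • ξ) * φ ξ‖ ≤ R ^ m * ∫ ξ, C * R ^ p * ‖φ ξ‖ := by gcongr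
    _ = _ := by rw [integral_const_mul]; ring

/-- Expansion of the rescaled pairing of a classical symbol with an annular function. -/
lemma IsCS.tendsto_expansion {n : ℕ} {χ : Euc n → ℝ} (hχ : IsCutoff χ) {a : ℂ}
    {σ : Euc n → ℂ} {σc : ℕ → Euc n → ℂ} (hσ : IsCS χ a σ σc) {φ : Euc n → ℂ}
    (hφ : IsAnnular φ) {m N : ℕ} (hN : m + a.re < N) :
    Tendsto (fun R : ℝ => (R : ℂ) ^ m * (∫ ξ, σ (R • ξ) * φ ξ)
      - ∑ j ∈ Finset.range N, (∫ ξ, σc j ξ * φ ξ) * (R : ℂ) ^ (m + a - j)) atTop (𝓝 0) := by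
  obtain ⟨C, -, hC⟩ := hσ.estimate N []
  have htail := hφ.tendsto_pow_mul_integral (m := m)
    (f := fun η => σ η - ∑ j ∈ Finset.range N, (χ η : ℂ) * σc j η)
    (p := a.re - N - ([] : List (Fin n)).length) (by simp; linarith) hC
  refine htail.congr' ?_
  filter_upwards [eventually_ge_atTop 1] with R hR
  have hR0 : 0 < R := by linarith
  have hRC : (R : ℂ) ≠ 0 := by exact_mod_cast hR0.ne'
  have hpt : ∀ ξ, (σ (R • ξ) - ∑ j ∈ Finset.range N, (χ (R • ξ) : ℂ) * σc j (R • ξ)) * φ ξ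
      = σ (R • ξ) * φ ξ - ∑ j ∈ Finset.range N, (R : ℂ) ^ (a - j) * (σc j ξ * φ ξ) := by
    intro ξ
    rcases lt_or_ge ‖ξ‖ 1 with hξ | hξ
    · simp [hφ.eq_zero ξ hξ]
    · have hξ0 : ξ ≠ 0 := by
        rintro rfl
        norm_num at hξ
      have hχ1 : χ (R • ξ) = 1 := hχ.one_far _ (by
        rw [norm_smul, Real.norm_of_nonneg hR0.le]
        nlinarith)
      rw [sub_mul, Finset.sum_mul, hχ1]
      congr 1
      refine Finset.sum_congr rfl fun j _ => ?_
      rw [hσ.comp_homog j R hR0 ξ hξ0]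
      simp [mul_assoc]
  have hcomp : ∀ j, Integrable fun ξ => σc j ξ * φ ξ :=
    fun j => hφ.integrable_mul (hσ.comp_smooth j).continuousOn
  have hcont : Continuous fun ξ => σ (R • ξ) := hσ.smooth.continuous.comp (continuous_const_smul R)
  simp only [hpt]
  rw [integral_sub (hφ.integrable_mul hcont.continuousOn)
      (integrable_finsetSum _ fun j _ => (hcomp j).const_mul _),
    integral_finsetSum _ fun j _ => (hcomp j).const_mul _, mul_sub, Finset.mul_sum]
  congr 1
  refine Finset.sum_congr rfl fun j _ => ?_
  rw [integral_const_mul, add_sub_assoc, Complex.cpow_add _ _ hRC, Complex.cpow_natCast]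
  ring

/-- Integration by parts for a rescaled function. -/
lemma mul_integral_pd_smul {n : ℕ} {τ φ : Euc n → ℂ} (hτ : ContDiff ℝ 1 τ)
    (hφ : ContDiff ℝ 1 φ) (hc : HasCompactSupport φ) (i : Fin n) (R : ℝ) :
    (R : ℂ) * ∫ ξ, pd i τ (R • ξ) * φ ξ = -∫ ξ, τ (R • ξ) * pd i φ ξ := by
  set v : Euc n := EuclideanSpace.single i 1
  set T : Euc n → ℂ := fun ξ => τ (R • ξ)
  have hT : ContDiff ℝ 1 T := hτ.comp (contDiff_const_smul R)
  have hder : ∀ ξ, fderiv ℝ T ξ v = R * pd i τ (R • ξ) := by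
    intro ξ
    have h1 : HasFDerivAt (fun η : Euc n => R • η) (R • ContinuousLinearMap.id ℝ (Euc n)) ξ :=
      (hasFDerivAt_id ξ).const_smul R
    have h2 := ((hτ.differentiable one_ne_zero (R • ξ)).hasFDerivAt).comp ξ h1
    change fderiv ℝ (τ ∘ fun η : Euc n => R • η) ξ v = _
    rw [h2.fderiv]
    simp [pd, v]
  have hdT : Continuous fun ξ => fderiv ℝ T ξ v :=
    (hT.continuous_fderiv one_ne_zero).clm_apply continuous_const
  have hdφ : Continuous fun ξ => fderiv ℝ φ ξ v :=
    (hφ.continuous_fderiv one_ne_zero).clm_apply continuous_const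
  have hibp := integral_mul_fderiv_eq_neg_fderiv_mul_of_integrable (μ := volume) (𝕜 := ℂ)
    (f := T) (g := φ) (v := v)
    ((hdT.mul hφ.continuous).integrable_of_hasCompactSupport hc.mul_left)
    ((hT.continuous.mul hdφ).integrable_of_hasCompactSupport
      (hc.fderiv_apply (𝕜 := ℝ) v).mul_left)
    ((hT.continuous.mul hφ.continuous).integrable_of_hasCompactSupport hc.mul_left)
    (fun x _ => hT.differentiable one_ne_zero x) (fun x _ => hφ.differentiable one_ne_zero x)
  rw [← integral_const_mul]
  change _ = -∫ ξ, T ξ * fderiv ℝ φ ξ v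
  rw [hibp, neg_neg]
  simp only [hder, mul_assoc]

/-- A bump function on the line supported in `[2, 4]`. -/
def radialBump : ContDiffBump (3 : ℝ) := ⟨1 / 2, 1, by norm_num, by norm_num⟩

/-- A smooth radial function supported in the annulus `2 ≤ ‖ξ‖² ≤ 4`. -/
def annularBump (n : ℕ) (ξ : Euc n) : ℂ := (radialBump (‖ξ‖ ^ 2) : ℂ)

lemma contDiff_radialBump : ContDiff ℝ (⊤ : ℕ∞) (radialBump : ℝ → ℝ) := radialBump.contDiff

lemma radialBump_eq_zero {t : ℝ} (ht : t ≤ 2 ∨ 4 ≤ t) : radialBump t = 0 := by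
  refine radialBump.zero_of_le_dist ?_
  change 1 ≤ |t - 3|
  rw [le_abs]
  rcases ht with ht | ht
  · right; linarith
  · left; linarith

lemma contDiff_annularBump (n : ℕ) : ContDiff ℝ (⊤ : ℕ∞) (annularBump n) :=
  Complex.ofRealCLM.contDiff.comp (contDiff_radialBump.comp (contDiff_norm_sq ℝ))

lemma isAnnular_annularBump (n : ℕ) : IsAnnular (annularBump n) where
  continuous := (contDiff_annularBump n).continuous
  hasCompactSupport := by
    refine HasCompactSupport.of_support_subset_isCompact (isCompact_closedBall (0 : Euc n) 2) ?_
    intro ξ hξ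
    by_contra hcon
    rw [mem_closedBall_zero_iff, not_le] at hcon
    refine hξ ?_
    rw [annularBump, radialBump_eq_zero (Or.inr (by nlinarith)), Complex.ofReal_zero]
  eq_zero ξ hξ := by
    have := norm_nonneg ξ
    rw [annularBump, radialBump_eq_zero (Or.inl (by nlinarith)), Complex.ofReal_zero]

lemma pd_annularBump {n : ℕ} (i : Fin n) (ξ : Euc n) :
    pd i (annularBump n) ξ = ((deriv radialBump (‖ξ‖ ^ 2) * (2 * ξ i) : ℝ) : ℂ) := by
  have h1 : HasFDerivAt (fun η : Euc n => ‖η‖ ^ 2) (2 • innerSL ℝ ξ) ξ :=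
    (hasStrictFDerivAt_norm_sq ξ).hasFDerivAt
  have h2 := ((contDiff_radialBump.differentiable (by simp) (‖ξ‖ ^ 2)).hasDerivAt).comp_hasFDerivAt
    ξ h1
  have h3 := Complex.ofRealCLM.hasFDerivAt.comp ξ h2
  change fderiv ℝ (Complex.ofRealCLM ∘ (radialBump : ℝ → ℝ) ∘ fun η : Euc n => ‖η‖ ^ 2) ξ _ = _
  rw [h3.fderiv]
  simp [EuclideanSpace.inner_single_right]

lemma isAnnular_pd_annularBump {n : ℕ} (i : Fin n) : IsAnnular (pd i (annularBump n)) where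
  continuous :=
    ((contDiff_annularBump n).continuous_fderiv (by simp)).clm_apply continuous_const
  hasCompactSupport := (isAnnular_annularBump n).hasCompactSupport.fderiv_apply (𝕜 := ℝ) _
  eq_zero ξ hξ := by
    have hzero : annularBump n =ᶠ[𝓝 ξ] fun _ => 0 := by
      filter_upwards [isOpen_ball.mem_nhds (mem_ball_zero_iff.mpr hξ)] with η hη
      exact (isAnnular_annularBump n).eq_zero η (mem_ball_zero_iff.mp hη)
    simp [pd, hzero.fderiv_eq]

/-- A function homogeneous of degree `1 - n` is orthogonal to the derivatives of the
annular bump. -/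
lemma integral_mul_pd_annularBump {n : ℕ} (hn : n ≠ 0) (i : Fin n) {f : Euc n → ℂ} {d : ℂ}
    (hd : n - 1 + d = 0)
    (hf : ∀ t : ℝ, 0 < t → ∀ ξ : Euc n, ξ ≠ 0 → f (t • ξ) = (t : ℂ) ^ d * f ξ) :
    ∫ ξ, f ξ * pd i (annularBump n) ξ = 0 := by
  have hpt : ∀ ξ : Euc n, f ξ * pd i (annularBump n) ξ =
      ((‖ξ‖ : ℂ) ^ d * ((deriv radialBump (‖ξ‖ ^ 2) * (2 * ‖ξ‖) : ℝ) : ℂ)) *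
        (f (‖ξ‖⁻¹ • ξ) * (((‖ξ‖⁻¹ • ξ) i : ℝ) : ℂ)) := by
    intro ξ
    by_cases hξ : ξ = 0
    · simp [hξ, pd_annularBump]
    · have hpos : 0 < ‖ξ‖ := norm_pos_iff.mpr hξ
      have hu : ‖ξ‖⁻¹ • ξ ≠ 0 := smul_ne_zero (inv_ne_zero hpos.ne') hξ
      have hfξ := hf ‖ξ‖ hpos _ hu
      rw [smul_inv_smul₀ hpos.ne'] at hfξ
      have hne : (‖ξ‖ : ℂ) ≠ 0 := by exact_mod_cast hpos.ne'
      rw [hfξ, pd_annularBump]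
      simp only [PiLp.smul_apply, smul_eq_mul]
      push_cast
      field_simp
  simp only [hpt]
  rw [integral_radial_mul_angular hn
    (fun r => (r : ℂ) ^ d * ((deriv radialBump (r ^ 2) * (2 * r) : ℝ) : ℂ))
    (fun ξ => f ξ * ((ξ i : ℝ) : ℂ))]
  have hder : ∀ r : ℝ, HasDerivAt (fun r : ℝ => radialBump (r ^ 2))
      (deriv radialBump (r ^ 2) * (2 * r)) r := fun r => by
    have := ((contDiff_radialBump.differentiable (by simp) (r ^ 2)).hasDerivAt).comp r
      (hasDerivAt_pow 2 r)
    simpa [Function.comp_def] using this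
  have hsmooth : ContDiff ℝ 1 fun r : ℝ => radialBump (r ^ 2) :=
    (contDiff_radialBump.comp (contDiff_id.pow 2)).of_le (by exact_mod_cast le_top)
  have hcs : HasCompactSupport fun r : ℝ => radialBump (r ^ 2) := by
    refine HasCompactSupport.of_support_subset_isCompact (isCompact_closedBall (0 : ℝ) 2) ?_
    intro r hr
    by_contra hcon
    rw [mem_closedBall_zero_iff, not_le, Real.norm_eq_abs] at hcon
    refine hr (radialBump_eq_zero (Or.inr ?_))
    rw [← sq_abs]
    nlinarith
  have hradial : ∫ r in Set.Ioi (0 : ℝ), deriv radialBump (r ^ 2) * (2 * r) = 0 := by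
    have := hcs.integral_Ioi_deriv_eq hsmooth 0
    simpa [funext fun r => (hder r).deriv, radialBump_eq_zero] using this
  have hcongr : ∫ r in Set.Ioi (0 : ℝ), (r : ℂ) ^ (n - 1) *
      ((r : ℂ) ^ d * ((deriv radialBump (r ^ 2) * (2 * r) : ℝ) : ℂ))
      = ∫ r in Set.Ioi (0 : ℝ), ((deriv radialBump (r ^ 2) * (2 * r) : ℝ) : ℂ) := by
    refine setIntegral_congr_fun measurableSet_Ioi fun r hr => ?_
    have hrC : (r : ℂ) ≠ 0 := by exact_mod_cast (ne_of_gt hr)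
    rw [← mul_assoc, ← Complex.cpow_natCast, ← Complex.cpow_add _ _ hrC,
      Nat.cast_pred (Nat.pos_of_ne_zero hn), hd, Complex.cpow_zero, one_mul]
  rw [hcongr, integral_complex_ofReal, hradial, Complex.ofReal_zero, mul_zero]

/-- Pairing a function homogeneous of degree `-n` with the annular bump detects its integral
over the sphere. -/
lemma sphInt_eq_zero_of_integral_mul_annularBump {n : ℕ} (hn : n ≠ 0) {f : Euc n → ℂ} {d : ℂ}
    (hd : n + d = 0)
    (hf : ∀ t : ℝ, 0 < t → ∀ ξ : Euc n, ξ ≠ 0 → f (t • ξ) = (t : ℂ) ^ d * f ξ)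
    (h : ∫ ξ, f ξ * annularBump n ξ = 0) : sphInt f = 0 := by
  have hpt : ∀ ξ : Euc n, f ξ * annularBump n ξ =
      ((‖ξ‖ : ℂ) ^ d * (radialBump (‖ξ‖ ^ 2) : ℂ)) * f (‖ξ‖⁻¹ • ξ) := by
    intro ξ
    by_cases hξ : ξ = 0
    · simp [hξ, annularBump, radialBump_eq_zero]
    · have hpos : 0 < ‖ξ‖ := norm_pos_iff.mpr hξ
      have hfξ := hf ‖ξ‖ hpos _ (smul_ne_zero (inv_ne_zero hpos.ne') hξ)
      rw [smul_inv_smul₀ hpos.ne'] at hfξ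
      rw [hfξ, annularBump]
      ring
  simp only [hpt] at h
  rw [integral_radial_mul_angular hn (fun r => (r : ℂ) ^ d * (radialBump (r ^ 2) : ℂ)) f] at h
  refine (mul_eq_zero.mp h).resolve_right ?_
  have hcongr : ∫ r in Set.Ioi (0 : ℝ), (r : ℂ) ^ (n - 1) *
      ((r : ℂ) ^ d * (radialBump (r ^ 2) : ℂ))
      = ∫ r in Set.Ioi (0 : ℝ), ((r⁻¹ * radialBump (r ^ 2) : ℝ) : ℂ) := by
    refine setIntegral_congr_fun measurableSet_Ioi fun r hr => ?_
    have hrC : (r : ℂ) ≠ 0 := by exact_mod_cast (ne_of_gt hr)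
    rw [← mul_assoc, ← Complex.cpow_natCast, ← Complex.cpow_add _ _ hrC,
      Nat.cast_pred (Nat.pos_of_ne_zero hn), show (n : ℂ) - 1 + d = -1 by linear_combination hd,
      Complex.cpow_neg_one]
    push_cast
    rfl
  rw [hcongr, integral_complex_ofReal, ← Ne, Complex.ofReal_ne_zero]
  set g : ℝ → ℝ := fun r => r⁻¹ * radialBump (r ^ 2)
  have hbound : ∀ r, r ∉ Set.Icc (1 : ℝ) 2 → 0 < r → g r = 0 := by
    intro r hr hr0
    have : r ^ 2 ≤ 2 ∨ 4 ≤ r ^ 2 := by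
      by_cases h1 : 1 ≤ r
      · right
        have : 2 < r := not_le.mp fun h2 => hr ⟨h1, h2⟩
        nlinarith
      · left
        nlinarith
    simp [g, radialBump_eq_zero this]
  have hgcont : ContinuousOn g (Set.Icc 1 2) :=
    (continuousOn_id.inv₀ fun r hr => by simp only [id]; linarith [hr.1]).mul
      (contDiff_radialBump.continuous.comp (continuous_pow 2)).continuousOn
  have hsub : Set.Icc (1 : ℝ) 2 ⊆ Set.Ioi 0 := fun r hr => lt_of_lt_of_le one_pos hr.1
  rw [setIntegral_eq_of_subset_of_forall_sdiff_eq_zero measurableSet_Ioi hsub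
      fun r hr => hbound r hr.2 hr.1,
    integral_Icc_eq_integral_Ioc, ← intervalIntegral.integral_of_le one_le_two]
  refine (intervalIntegral.integral_pos one_lt_two hgcont (fun r hr => ?_) ?_).ne'
  · exact mul_nonneg (inv_nonneg.mpr (by linarith [hr.1])) radialBump.nonneg
  · refine ⟨7 / 4, by norm_num, mul_pos (by norm_num) (radialBump.pos_of_mem_ball ?_)⟩
    rw [mem_ball, Real.dist_eq]
    change _ < (1 : ℝ)
    rw [abs_lt]
    norm_num

/-- **Stokes' property for the noncommutative residue**: if `σ ∼ ∂_{ξ_i} τ` up to a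
smoothing symbol, then `res σ = 0`. -/
theorem res_vanishes_on_derivatives {n : ℕ} (hn : 2 ≤ n) {χ : Euc n → ℝ}
    (hχ : IsCutoff χ) (a b : ℂ) (σ τ : Euc n → ℂ) (σc τc : ℕ → Euc n → ℂ)
    (hσ : IsCS χ a σ σc) (hτ : IsCS χ b τ τc) (i : Fin n)
    (h : IsSmoothing (fun ξ => σ ξ - pd i τ ξ)) :
    resCC a σc = 0 := by
  have hn0 : n ≠ 0 := by omega
  unfold resCC
  split_ifs with hJ
  swap
  · rfl
  set J := hJ.choose
  have hJa : a - J = -(n : ℂ) := hJ.choose_spec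
  rw [sphInt_eq_zero_of_integral_mul_annularBump hn0 (d := a - J) (by rw [hJa]; ring)
    (hσ.comp_homog J) ?_, mul_zero]
  set φ := annularBump n
  have hφ : IsAnnular φ := isAnnular_annularBump n
  have hφs : ContDiff ℝ 1 φ := (contDiff_annularBump n).of_le (by exact_mod_cast le_top)
  have hτs : ContDiff ℝ 1 τ := hτ.smooth.of_le (by exact_mod_cast le_top)
  obtain ⟨N, hN⟩ := exists_nat_gt (n + a.re)
  obtain ⟨K, hK⟩ := exists_nat_gt ((n - 1 : ℕ) + b.re)
  have hσlim := hσ.tendsto_expansion hχ hφ hN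
  have hτlim := hτ.tendsto_expansion hχ (isAnnular_pd_annularBump i) hK
  obtain ⟨C, -, hC⟩ := h.2 [] (n + 1) (by positivity)
  have hρlim := hφ.tendsto_pow_mul_integral (m := n) (by linarith) hC
  have hkey : ∀ R : ℝ, (R : ℂ) ^ n * (∫ ξ, (σ (R • ξ) - pd i τ (R • ξ)) * φ ξ)
      = (R : ℂ) ^ n * (∫ ξ, σ (R • ξ) * φ ξ)
        + (R : ℂ) ^ (n - 1) * ∫ ξ, τ (R • ξ) * pd i φ ξ := by
    intro R
    have hdτ : Continuous (pd i τ) :=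
      (hτs.continuous_fderiv one_ne_zero).clm_apply continuous_const
    have hibp := mul_integral_pd_smul hτs hφs hφ.hasCompactSupport i R
    have hpow : (R : ℂ) ^ n = (R : ℂ) ^ (n - 1) * R := by
      rw [← pow_succ, Nat.sub_add_cancel (Nat.pos_of_ne_zero hn0)]
    simp only [sub_mul]
    have hσR : Continuous fun ξ => σ (R • ξ) :=
      hσ.smooth.continuous.comp (continuous_const_smul R)
    have hτR : Continuous fun ξ => pd i τ (R • ξ) := hdτ.comp (continuous_const_smul R)
    rw [integral_sub (hφ.integrable_mul hσR.continuousOn) (hφ.integrable_mul hτR.continuousOn),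
      hpow]
    linear_combination (-(R : ℂ) ^ (n - 1)) * hibp
  have hlim := sum_filter_eq_zero_of_tendsto_sum_cpow
    ((Finset.range N).disjSum (Finset.range K))
    (Sum.elim (fun j : ℕ => (n : ℂ) + a - j) (fun k : ℕ => ((n - 1 : ℕ) : ℂ) + b - k))
    (Sum.elim (fun j => ∫ ξ, σc j ξ * φ ξ) (fun k => ∫ ξ, τc k ξ * pd i φ ξ)) (by
      have := hρlim.sub (hσlim.add hτlim)
      rw [add_zero, sub_zero] at this
      refine this.congr fun R => ?_
      have hR := hkey R
      simp only [pdIter] at hR ⊢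
      rw [hR, Finset.sum_disjSum]
      simp only [Sum.elim_inl, Sum.elim_inr]
      ring)
  have hJN : J ∈ Finset.range N := by
    have hre := congrArg Complex.re hJa
    simp only [Complex.sub_re, Complex.natCast_re, Complex.neg_re] at hre
    rw [Finset.mem_range]
    exact_mod_cast (show (J : ℝ) < N by linarith)
  rwa [Finset.sum_eq_single_of_mem (Sum.inl J)] at hlim
  · rw [Finset.mem_filter, Finset.inl_mem_disjSum]
    exact ⟨hJN, by simp only [Sum.elim_inl]; linear_combination hJa⟩
  · rintro (j | k) hs hne
    · have hj := (Finset.mem_filter.mp hs).2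
      simp only [Sum.elim_inl] at hj
      refine absurd ?_ hne
      have : (j : ℂ) = J := by linear_combination hJa - hj
      rw [Nat.cast_injective this]
    · have hk := (Finset.mem_filter.mp hs).2
      simp only [Sum.elim_inr] at hk ⊢
      refine integral_mul_pd_annularBump hn0 i (d := b - k) ?_ (hτ.comp_homog k)
      rw [Nat.cast_pred (Nat.pos_of_ne_zero hn0)] at hk
      linear_combination hk

end
end

section
/- Let σ be a classical symbol of order a ∈ ℂ with constant coefficients on ℝⁿ (n ≥ 2) with vanishing residue, res(σ) = 0. Then there exist classical symbols τ_1,…,τ_n of order a+1 with constant coefficients such that σ ∼ ∑_{i=1}^n ∂_{ξ_i}τ_i, i.e. σ − ∑_{i=1}^n ∂_{ξ_i}τ_i is a smoothing symbol. -/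
open MeasureTheory Metric Filter Complex
open scoped Topology RealInnerProductSpace Classical

noncomputable section

section PartialDerivatives

variable {n : ℕ}

theorem sum_smul_single (v : Euc n) : ∑ i, v i • EuclideanSpace.single i (1 : ℝ) = v := by
  ext j
  simp [Pi.single_apply]

theorem fderiv_apply_eq_sum_pd (f : Euc n → ℂ) (x v : Euc n) :
    fderiv ℝ f x v = ∑ i, (v i : ℂ) * pd i f x := by
  conv_lhs => rw [← sum_smul_single v]
  simp [pd, map_sum]

/-- The map sending `c` to the linear form `v ↦ v i * c`. -/
def coordSmulRight (i : Fin n) : ℂ →L[ℝ] Euc n →L[ℝ] ℂ :=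
  ContinuousLinearMap.smulRightL ℝ (Euc n) ℂ (EuclideanSpace.proj i)

theorem coordSmulRight_apply (i : Fin n) (c : ℂ) (v : Euc n) :
    coordSmulRight i c v = v i * c := by
  simp [coordSmulRight]

theorem fderiv_eq_sum_pd (f : Euc n → ℂ) (x : Euc n) :
    fderiv ℝ f x = ∑ i, coordSmulRight i (pd i f x) := by
  ext v
  simp [fderiv_apply_eq_sum_pd, coordSmulRight_apply]

theorem norm_coordSmulRight_le (i : Fin n) (c : ℂ) : ‖coordSmulRight i c‖ ≤ ‖c‖ := by
  rw [coordSmulRight, ContinuousLinearMap.smulRightL_apply_apply,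
    ContinuousLinearMap.norm_smulRight_apply]
  refine mul_le_of_le_one_left (norm_nonneg _) ?_
  refine ContinuousLinearMap.opNorm_le_bound _ zero_le_one fun x => ?_
  simpa using PiLp.norm_apply_le x i

theorem contDiffOn_pd {U : Set (Euc n)} (hU : IsOpen U) {f : Euc n → ℂ}
    (hf : ContDiffOn ℝ (⊤ : ℕ∞) f U) (i : Fin n) : ContDiffOn ℝ (⊤ : ℕ∞) (pd i f) U :=
  ((contDiffOn_infty_iff_fderiv_of_isOpen hU).1 hf).2.clm_apply contDiffOn_const

theorem contDiff_pd {f : Euc n → ℂ} (hf : ContDiff ℝ (⊤ : ℕ∞) f) (i : Fin n) :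
    ContDiff ℝ (⊤ : ℕ∞) (pd i f) :=
  contDiffOn_univ.1 (contDiffOn_pd isOpen_univ hf.contDiffOn i)

theorem contDiffOn_pdIter {U : Set (Euc n)} (hU : IsOpen U) {f : Euc n → ℂ}
    (hf : ContDiffOn ℝ (⊤ : ℕ∞) f U) (L : List (Fin n)) :
    ContDiffOn ℝ (⊤ : ℕ∞) (pdIter L f) U := by
  induction L with
  | nil => exact hf
  | cons i L ih => exact contDiffOn_pd hU ih i

theorem contDiff_pdIter {f : Euc n → ℂ} (hf : ContDiff ℝ (⊤ : ℕ∞) f) (L : List (Fin n)) :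
    ContDiff ℝ (⊤ : ℕ∞) (pdIter L f) :=
  contDiffOn_univ.1 (contDiffOn_pdIter isOpen_univ hf.contDiffOn L)

theorem pd_congr {U : Set (Euc n)} (hU : IsOpen U) {f g : Euc n → ℂ} (h : Set.EqOn f g U)
    (i : Fin n) : Set.EqOn (pd i f) (pd i g) U := fun x hx => by
  simp only [pd]
  rw [(h.eventuallyEq_of_mem (hU.mem_nhds hx)).fderiv_eq]

theorem pdIter_congr {U : Set (Euc n)} (hU : IsOpen U) {f g : Euc n → ℂ} (h : Set.EqOn f g U)
    (L : List (Fin n)) : Set.EqOn (pdIter L f) (pdIter L g) U := by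
  induction L with
  | nil => exact h
  | cons i L ih => exact pd_congr hU ih i

theorem pdIter_concat (L : List (Fin n)) (i : Fin n) (f : Euc n → ℂ) :
    pdIter (L ++ [i]) f = pdIter L (pd i f) := by
  induction L with
  | nil => rfl
  | cons j L ih => simp [pdIter, ih]

theorem differentiableAt_of_contDiffOn {U : Set (Euc n)} (hU : IsOpen U) {f : Euc n → ℂ}
    (hf : ContDiffOn ℝ (⊤ : ℕ∞) f U) {x : Euc n} (hx : x ∈ U) : DifferentiableAt ℝ f x :=
  (hf.contDiffAt (hU.mem_nhds hx)).differentiableAt (by simp)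

theorem pd_zero (i : Fin n) : pd i (fun _ : Euc n => (0 : ℂ)) = fun _ => 0 := by
  ext x
  simp [pd]

theorem pdIter_zero (L : List (Fin n)) : pdIter L (fun _ : Euc n => (0 : ℂ)) = fun _ => 0 := by
  induction L with
  | nil => rfl
  | cons i L ih => rw [pdIter, ih, pd_zero]

theorem pd_add {f g : Euc n → ℂ} {x : Euc n} (hf : DifferentiableAt ℝ f x)
    (hg : DifferentiableAt ℝ g x) (i : Fin n) :
    pd i (fun y => f y + g y) x = pd i f x + pd i g x := by
  simp [pd, fderiv_fun_add hf hg]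

theorem pd_sub {f g : Euc n → ℂ} {x : Euc n} (hf : DifferentiableAt ℝ f x)
    (hg : DifferentiableAt ℝ g x) (i : Fin n) :
    pd i (fun y => f y - g y) x = pd i f x - pd i g x := by
  simp [pd, fderiv_fun_sub hf hg]

theorem pd_mul {f g : Euc n → ℂ} {x : Euc n} (hf : DifferentiableAt ℝ f x)
    (hg : DifferentiableAt ℝ g x) (i : Fin n) :
    pd i (fun y => f y * g y) x = pd i f x * g x + f x * pd i g x := by
  simp only [pd]
  rw [fderiv_fun_mul hf hg]
  simp
  ring

theorem pd_const_mul (c : ℂ) {f : Euc n → ℂ} {x : Euc n} (hf : DifferentiableAt ℝ f x)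
    (i : Fin n) : pd i (fun y => c * f y) x = c * pd i f x := by
  simp [pd, fderiv_const_mul hf]

theorem pd_sum {ι : Type*} (s : Finset ι) {f : ι → Euc n → ℂ} {x : Euc n}
    (hf : ∀ j ∈ s, DifferentiableAt ℝ (f j) x) (i : Fin n) :
    pd i (fun y => ∑ j ∈ s, f j y) x = ∑ j ∈ s, pd i (f j) x := by
  simp [pd, fderiv_fun_sum hf]

theorem pd_coord (i j : Fin n) (x : Euc n) :
    pd i (fun y : Euc n => (y j : ℂ)) x = if i = j then 1 else 0 := by
  have h : HasFDerivAt (fun y : Euc n => (y j : ℂ))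
      (ofRealCLM.comp (EuclideanSpace.proj j : Euc n →L[ℝ] ℝ)) x :=
    (ofRealCLM.comp (EuclideanSpace.proj j : Euc n →L[ℝ] ℝ)).hasFDerivAt
  simp only [pd, h.fderiv]
  by_cases hij : i = j
  · simp [hij]
  · simp [hij, Ne.symm hij]

theorem contDiff_coord (j : Fin n) : ContDiff ℝ (⊤ : ℕ∞) (fun y : Euc n => (y j : ℂ)) :=
  (ofRealCLM.comp (EuclideanSpace.proj j : Euc n →L[ℝ] ℝ)).contDiff

theorem pdIter_const_mul_comp_affine {f : Euc n → ℂ} (hf : ContDiff ℝ (⊤ : ℕ∞) f) (c : ℂ)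
    (t : ℝ) (w : Euc n) (L : List (Fin n)) :
    pdIter L (fun x => c * f (t • x - w)) =
      fun x => c * (t : ℂ) ^ L.length * pdIter L f (t • x - w) := by
  induction L with
  | nil => simp [pdIter]
  | cons i L ih =>
    have hL := contDiff_pdIter hf L
    ext x
    have h1 : HasFDerivAt (fun y : Euc n => t • y - w) (t • ContinuousLinearMap.id ℝ (Euc n)) x :=
      ((hasFDerivAt_id x).const_smul t).sub_const w
    have h2 := (hL.differentiable (by simp) (t • x - w)).hasFDerivAt.comp x h1
    rw [pdIter, ih]
    rw [pd_const_mul (f := fun y => pdIter L f (t • y - w)) _ h2.differentiableAt]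
    have h3 : pd i (pdIter L f ∘ fun y => t • y - w) x = t * pdIter (i :: L) f (t • x - w) := by
      simp only [pd, pdIter]
      rw [h2.fderiv]
      simp
    have h4 : pd i (fun y => pdIter L f (t • y - w)) x = t * pdIter (i :: L) f (t • x - w) := h3
    rw [h4, List.length_cons, pow_succ]
    ring

end PartialDerivatives

section ParametricIntegrals

variable {n : ℕ} {T : Type*} [MeasurableSpace T]

/-- A family of smooth functions all of whose derivatives are, locally uniformly on `U`,
dominated by an integrable function of the parameter. -/
structure IsDominatedFamily (μ : Measure T) (U : Set (Euc n)) (g : T → Euc n → ℂ) : Prop where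
  smooth : ∀ t, ContDiff ℝ (⊤ : ℕ∞) (g t)
  meas : ∀ L, ∀ x ∈ U, AEStronglyMeasurable (fun t => pdIter L (g t) x) μ
  dom : ∀ L, ∀ x ∈ U, ∃ b : T → ℝ, Integrable b μ ∧ ∃ s ∈ 𝓝 x,
    ∀ᵐ t ∂μ, ∀ y ∈ s, ‖pdIter L (g t) y‖ ≤ b t

namespace IsDominatedFamily

variable {μ : Measure T} {U : Set (Euc n)} {g : T → Euc n → ℂ}

theorem integrable (h : IsDominatedFamily μ U g) (L : List (Fin n)) {x : Euc n} (hx : x ∈ U) :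
    Integrable (fun t => pdIter L (g t) x) μ := by
  obtain ⟨b, hb, s, hs, hbs⟩ := h.dom L x hx
  refine hb.mono' (h.meas L x hx) ?_
  filter_upwards [hbs] with t ht using ht x (mem_of_mem_nhds hs)

theorem deriv (h : IsDominatedFamily μ U g) (i : Fin n) :
    IsDominatedFamily μ U (fun t => pd i (g t)) where
  smooth t := contDiff_pd (h.smooth t) i
  meas L x hx := by simpa only [pdIter_concat] using h.meas (L ++ [i]) x hx
  dom L x hx := by simpa only [pdIter_concat] using h.dom (L ++ [i]) x hx

theorem hasFDerivAt (h : IsDominatedFamily μ U g) (hU : IsOpen U) {x : Euc n} (hx : x ∈ U) :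
    HasFDerivAt (fun y => ∫ t, g t y ∂μ) (∫ t, fderiv ℝ (g t) x ∂μ) x := by
  choose b hb s hs hbs using fun i => h.dom [i] x hx
  refine hasFDerivAt_integral_of_dominated_of_fderiv_le (s := ⋂ i, s i)
    (F := fun y t => g t y) (F' := fun y t => fderiv ℝ (g t) y)
    (bound := fun t => ∑ i, b i t) (Filter.iInter_mem.2 hs) ?_ (h.integrable [] hx) ?_ ?_
    (integrable_finsetSum _ fun i _ => hb i) ?_
  · filter_upwards [hU.mem_nhds hx] with y hy using h.meas [] y hy
  · simp_rw [fderiv_eq_sum_pd]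
    refine Finset.aestronglyMeasurable_fun_sum _ fun i _ => ?_
    exact (coordSmulRight i).continuous.comp_aestronglyMeasurable (h.meas [i] x hx)
  · filter_upwards [ae_all_iff.2 hbs] with t ht y hy
    rw [fderiv_eq_sum_pd]
    refine (norm_sum_le _ _).trans (Finset.sum_le_sum fun i _ => ?_)
    exact (norm_coordSmulRight_le _ _).trans (ht i y (Set.mem_iInter.1 hy i))
  · exact Eventually.of_forall fun t y _ =>
      ((h.smooth t).differentiable (by simp) y).hasFDerivAt

theorem pd_integral (h : IsDominatedFamily μ U g) (hU : IsOpen U) (i : Fin n) {x : Euc n}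
    (hx : x ∈ U) : pd i (fun y => ∫ t, g t y ∂μ) x = ∫ t, pd i (g t) x ∂μ := by
  have hint : Integrable (fun t => fderiv ℝ (g t) x) μ := by
    simp_rw [fderiv_eq_sum_pd]
    refine integrable_finsetSum (f := fun i t => coordSmulRight i (pd i (g t) x)) _ fun i _ => ?_
    exact (coordSmulRight i).integrable_comp (h.integrable [i] hx)
  simp only [pd]
  rw [(h.hasFDerivAt hU hx).fderiv, ContinuousLinearMap.integral_apply hint]

theorem pdIter_integral (h : IsDominatedFamily μ U g) (hU : IsOpen U) (L : List (Fin n))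
    {x : Euc n} (hx : x ∈ U) :
    pdIter L (fun y => ∫ t, g t y ∂μ) x = ∫ t, pdIter L (g t) x ∂μ := by
  induction L using List.reverseRecOn generalizing g with
  | nil => rfl
  | append_singleton L i ih =>
    simp_rw [pdIter_concat]
    rw [pdIter_congr hU (fun y hy => h.pd_integral hU i hy) L hx, ih (h.deriv i)]

theorem contDiffOn (h : IsDominatedFamily μ U g) (hU : IsOpen U) :
    ContDiffOn ℝ (⊤ : ℕ∞) (fun y => ∫ t, g t y ∂μ) U := by
  refine contDiffOn_infty.2 fun k => ?_
  induction k generalizing g with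
  | zero =>
    exact contDiffOn_zero.2 fun x hx => (h.hasFDerivAt hU hx).continuousAt.continuousWithinAt
  | succ k ih =>
    push_cast
    refine (contDiffOn_succ_iff_fderiv_of_isOpen hU).2 ⟨fun x hx =>
      (h.hasFDerivAt hU hx).differentiableAt.differentiableWithinAt, by simp, ?_⟩
    simp_rw [funext (fderiv_eq_sum_pd _)]
    refine ContDiffOn.sum fun i _ => ?_
    refine (coordSmulRight i).contDiff.comp_contDiffOn ?_
    exact (ih (h.deriv i)).congr fun x hx => h.pd_integral hU i hx

end IsDominatedFamily

end ParametricIntegrals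

section Homogeneous

variable {n : ℕ}

/-- A function smooth and positively homogeneous of degree `z` away from the origin. -/
structure IsHomogeneousSmooth (z : ℂ) (f : Euc n → ℂ) : Prop where
  smooth : ContDiffOn ℝ (⊤ : ℕ∞) f {(0 : Euc n)}ᶜ
  homog : ∀ t : ℝ, 0 < t → ∀ ξ : Euc n, ξ ≠ 0 → f (t • ξ) = (t : ℂ) ^ z * f ξ

namespace IsHomogeneousSmooth

variable {z w : ℂ} {f g : Euc n → ℂ}

theorem differentiableAt (hf : IsHomogeneousSmooth z f) {ξ : Euc n} (hξ : ξ ≠ 0) :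
    DifferentiableAt ℝ f ξ :=
  differentiableAt_of_contDiffOn isOpen_compl_singleton hf.smooth hξ

theorem mul (hf : IsHomogeneousSmooth z f) (hg : IsHomogeneousSmooth w g) :
    IsHomogeneousSmooth (z + w) (fun ξ => f ξ * g ξ) where
  smooth := hf.smooth.mul hg.smooth
  homog t ht ξ hξ := by
    rw [hf.homog t ht ξ hξ, hg.homog t ht ξ hξ, cpow_add _ _ (ofReal_ne_zero.2 ht.ne')]
    ring

theorem const_mul (hf : IsHomogeneousSmooth z f) (c : ℂ) :
    IsHomogeneousSmooth z (fun ξ => c * f ξ) where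
  smooth := contDiffOn_const.mul hf.smooth
  homog t ht ξ hξ := by
    rw [hf.homog t ht ξ hξ]
    ring

theorem coord (i : Fin n) : IsHomogeneousSmooth 1 (fun ξ : Euc n => (ξ i : ℂ)) where
  smooth := (contDiff_coord i).contDiffOn
  homog t ht ξ hξ := by simp

theorem pd (hf : IsHomogeneousSmooth z f) (i : Fin n) :
    IsHomogeneousSmooth (z - 1) (pd i f) where
  smooth := contDiffOn_pd isOpen_compl_singleton hf.smooth i
  homog t ht ξ hξ := by
    have ht' : (t : ℂ) ≠ 0 := ofReal_ne_zero.2 ht.ne'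
    have h1 := pd_congr (f := fun η => f (t • η)) isOpen_compl_singleton
      (fun η hη => hf.homog t ht η hη) i hξ
    rw [pd_const_mul _ (hf.differentiableAt hξ)] at h1
    have h2 : _root_.pd i (fun η => f (t • η)) ξ = t * _root_.pd i f (t • ξ) := by
      simp only [_root_.pd]
      rw [fderiv_comp_smul]
      simp
    rw [h2] at h1
    rw [cpow_sub _ _ ht', cpow_one, div_mul_eq_mul_div, eq_div_iff ht', ← h1]
    ring

/-- The Euler identity for homogeneous functions. -/
theorem sum_coord_mul_pd (hf : IsHomogeneousSmooth z f) {ξ : Euc n} (hξ : ξ ≠ 0) :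
    ∑ i, (ξ i : ℂ) * _root_.pd i f ξ = z * f ξ := by
  rw [← fderiv_apply_eq_sum_pd]
  have h1 : HasDerivAt (fun t : ℝ => f (t • ξ)) (fderiv ℝ f ξ ξ) 1 := by
    have ha : HasDerivAt (fun t : ℝ => t • ξ) ξ 1 := by
      simpa using (hasDerivAt_id (1 : ℝ)).smul_const ξ
    have hb : HasFDerivAt f (fderiv ℝ f ξ) ((1 : ℝ) • ξ) := by
      rw [one_smul]
      exact (hf.differentiableAt hξ).hasFDerivAt
    exact hb.comp_hasDerivAt (1 : ℝ) ha
  have h2 : HasDerivAt (fun t : ℝ => (t : ℂ) ^ z * f ξ) (z * f ξ) 1 := by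
    have ha : HasDerivAt (fun t : ℂ => t ^ z) z ((1 : ℝ) : ℂ) := by
      simpa using (hasDerivAt_id (1 : ℂ)).cpow_const (c := z) (by simp)
    exact ha.comp_ofReal.mul_const _
  refine h1.unique (h2.congr_of_eventuallyEq ?_)
  filter_upwards [lt_mem_nhds (zero_lt_one' ℝ)] with t ht using hf.homog t ht ξ hξ

theorem exists_norm_le (hf : IsHomogeneousSmooth z f) :
    ∃ C : ℝ, ∀ ξ : Euc n, ξ ≠ 0 → ‖f ξ‖ ≤ C * ‖ξ‖ ^ z.re := by
  obtain ⟨C, hC⟩ := (isCompact_sphere (0 : Euc n) 1).exists_bound_of_continuousOn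
    (hf.smooth.continuousOn.mono fun ξ hξ => ne_zero_of_mem_unit_sphere ⟨ξ, hξ⟩)
  refine ⟨C, fun ξ hξ => ?_⟩
  have hpos : 0 < ‖ξ‖ := norm_pos_iff.2 hξ
  have hs : ‖ξ‖⁻¹ • ξ ∈ sphere (0 : Euc n) 1 := by
    simp [norm_smul, hpos.ne']
  have h := hf.homog ‖ξ‖ hpos (‖ξ‖⁻¹ • ξ) (ne_zero_of_mem_unit_sphere ⟨_, hs⟩)
  rw [smul_smul, mul_inv_cancel₀ hpos.ne', one_smul] at h
  rw [h, norm_mul, norm_cpow_eq_rpow_re_of_pos hpos, mul_comm]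
  exact mul_le_mul_of_nonneg_right (hC _ hs) (by positivity)

theorem pdIter (hf : IsHomogeneousSmooth z f) (L : List (Fin n)) :
    IsHomogeneousSmooth (z - L.length) (pdIter L f) := by
  induction L with
  | nil => simpa [_root_.pdIter] using hf
  | cons i L ih =>
    rw [_root_.pdIter, List.length_cons, Nat.cast_succ, ← sub_sub]
    exact ih.pd i

theorem divergence_coord_mul (hf : IsHomogeneousSmooth z f) {ξ : Euc n} (hξ : ξ ≠ 0) :
    ∑ i, _root_.pd i (fun η => (η i : ℂ) * f η) ξ = (z + n) * f ξ := by
  have h : ∀ i, _root_.pd i (fun η => (η i : ℂ) * f η) ξ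
      = f ξ + (ξ i : ℂ) * _root_.pd i f ξ := fun i => by
    rw [pd_mul ((contDiff_coord i).differentiable (by simp) ξ) (hf.differentiableAt hξ),
      pd_coord, if_pos rfl, one_mul]
  simp_rw [h]
  rw [Finset.sum_add_distrib, hf.sum_coord_mul_pd hξ]
  simp
  ring

end IsHomogeneousSmooth

end Homogeneous

section SymbolsAtInfinity

variable {n : ℕ}

/-- Functions smooth away from the origin satisfying the symbol estimates of real order `r`
outside the unit ball. -/
structure IsSymbolAtInfinity (r : ℝ) (f : Euc n → ℂ) : Prop where
  smooth : ContDiffOn ℝ (⊤ : ℕ∞) f {(0 : Euc n)}ᶜ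
  bound : ∀ L : List (Fin n), ∃ C : ℝ, ∀ ξ : Euc n, 1 < ‖ξ‖ →
    ‖pdIter L f ξ‖ ≤ C * ‖ξ‖ ^ (r - L.length)

theorem ne_zero_of_one_lt_norm {ξ : Euc n} (hξ : 1 < ‖ξ‖) : ξ ≠ 0 :=
  norm_pos_iff.1 (zero_lt_one.trans hξ)

theorem isOpen_one_lt_norm : IsOpen {ξ : Euc n | 1 < ‖ξ‖} :=
  isOpen_lt continuous_const continuous_norm

theorem pdIter_add {U : Set (Euc n)} (hU : IsOpen U) {f g : Euc n → ℂ}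
    (hf : ContDiffOn ℝ (⊤ : ℕ∞) f U) (hg : ContDiffOn ℝ (⊤ : ℕ∞) g U) (L : List (Fin n))
    {x : Euc n} (hx : x ∈ U) :
    pdIter L (fun y => f y + g y) x = pdIter L f x + pdIter L g x := by
  induction L generalizing x with
  | nil => rfl
  | cons i L ih =>
    have h : Set.EqOn (pdIter L (fun y => f y + g y)) (fun y => pdIter L f y + pdIter L g y) U :=
      fun y hy => ih hy
    rw [pdIter, pd_congr hU h i hx,
      pd_add (differentiableAt_of_contDiffOn hU (contDiffOn_pdIter hU hf L) hx)
        (differentiableAt_of_contDiffOn hU (contDiffOn_pdIter hU hg L) hx)]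
    rfl

namespace IsSymbolAtInfinity

variable {r s : ℝ} {f g : Euc n → ℂ}

theorem zero (r : ℝ) : IsSymbolAtInfinity r (fun _ : Euc n => (0 : ℂ)) where
  smooth := contDiffOn_const
  bound L := ⟨0, fun ξ _ => by simp [pdIter_zero]⟩

theorem add (hf : IsSymbolAtInfinity r f) (hg : IsSymbolAtInfinity r g) :
    IsSymbolAtInfinity r (fun ξ => f ξ + g ξ) where
  smooth := hf.smooth.add hg.smooth
  bound L := by
    obtain ⟨C, hC⟩ := hf.bound L
    obtain ⟨D, hD⟩ := hg.bound L
    refine ⟨C + D, fun ξ hξ => ?_⟩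
    rw [pdIter_add isOpen_compl_singleton hf.smooth hg.smooth L (ne_zero_of_one_lt_norm hξ),
      add_mul]
    exact (norm_add_le _ _).trans (add_le_add (hC ξ hξ) (hD ξ hξ))

theorem sum {ι : Type*} (s : Finset ι) {f : ι → Euc n → ℂ}
    (hf : ∀ j ∈ s, IsSymbolAtInfinity r (f j)) :
    IsSymbolAtInfinity r (fun ξ => ∑ j ∈ s, f j ξ) := by
  induction s using Finset.induction_on with
  | empty => simpa using zero r
  | insert j s hj ih =>
    simp_rw [Finset.sum_insert hj]
    exact (hf j (Finset.mem_insert_self j s)).add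
      (ih fun k hk => hf k (Finset.mem_insert_of_mem hk))

theorem mono (hf : IsSymbolAtInfinity r f) (hrs : r ≤ s) : IsSymbolAtInfinity s f where
  smooth := hf.smooth
  bound L := by
    obtain ⟨C, hC⟩ := hf.bound L
    refine ⟨|C|, fun ξ hξ => (hC ξ hξ).trans ?_⟩
    exact mul_le_mul (le_abs_self C) (Real.rpow_le_rpow_of_exponent_le hξ.le (by linarith))
      (by positivity) (abs_nonneg C)

theorem pd (hf : IsSymbolAtInfinity r f) (i : Fin n) : IsSymbolAtInfinity (r - 1) (pd i f) where
  smooth := contDiffOn_pd isOpen_compl_singleton hf.smooth i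
  bound L := by
    obtain ⟨C, hC⟩ := hf.bound (L ++ [i])
    refine ⟨C, fun ξ hξ => ?_⟩
    have h := hC ξ hξ
    rw [pdIter_concat, List.length_append, List.length_singleton] at h
    convert h using 3
    push_cast
    ring

theorem exists_norm_pdIter_mul_le (hf : IsSymbolAtInfinity r f) (hg : IsSymbolAtInfinity s g)
    (L : List (Fin n)) : ∃ C : ℝ, ∀ ξ : Euc n, 1 < ‖ξ‖ →
      ‖pdIter L (fun η => f η * g η) ξ‖ ≤ C * ‖ξ‖ ^ (r + s - L.length) := by
  induction L using List.reverseRecOn generalizing r s f g with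
  | nil =>
    obtain ⟨C, hC⟩ := hf.bound []
    obtain ⟨D, hD⟩ := hg.bound []
    refine ⟨C * D, fun ξ hξ => ?_⟩
    have hpos : 0 < ‖ξ‖ := zero_lt_one.trans hξ
    have h := mul_le_mul (hC ξ hξ) (hD ξ hξ) (norm_nonneg _) ((norm_nonneg _).trans (hC ξ hξ))
    simp only [pdIter, List.length_nil, Nat.cast_zero, sub_zero] at h ⊢
    rw [norm_mul, Real.rpow_add hpos]
    calc _ ≤ _ := h
      _ = _ := by ring
  | append_singleton L i ih =>
    obtain ⟨C, hC⟩ := ih (hf.pd i) hg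
    obtain ⟨D, hD⟩ := ih hf (hg.pd i)
    refine ⟨C + D, fun ξ hξ => ?_⟩
    have hU : IsOpen ({(0 : Euc n)}ᶜ) := isOpen_compl_singleton
    have hξ' : ξ ∈ ({(0 : Euc n)}ᶜ : Set (Euc n)) := ne_zero_of_one_lt_norm hξ
    rw [pdIter_concat, pdIter_congr hU (fun y hy =>
        pd_mul (differentiableAt_of_contDiffOn hU hf.smooth hy)
          (differentiableAt_of_contDiffOn hU hg.smooth hy) i) L hξ',
      pdIter_add hU ((hf.pd i).smooth.mul hg.smooth) (hf.smooth.mul (hg.pd i).smooth) L hξ',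
      add_mul]
    refine (norm_add_le _ _).trans (add_le_add ?_ ?_)
    · have h : r + s - ((L ++ [i]).length : ℝ) = r - 1 + s - L.length := by
        rw [List.length_append, List.length_singleton]
        push_cast
        ring
      rw [h]
      exact hC ξ hξ
    · have h : r + s - ((L ++ [i]).length : ℝ) = r + (s - 1) - L.length := by
        rw [List.length_append, List.length_singleton]
        push_cast
        ring
      rw [h]
      exact hD ξ hξ

theorem mul (hf : IsSymbolAtInfinity r f) (hg : IsSymbolAtInfinity s g) :
    IsSymbolAtInfinity (r + s) (fun ξ => f ξ * g ξ) where
  smooth := hf.smooth.mul hg.smooth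
  bound := exists_norm_pdIter_mul_le hf hg

end IsSymbolAtInfinity

theorem IsHomogeneousSmooth.isSymbolAtInfinity {z : ℂ} {f : Euc n → ℂ}
    (hf : IsHomogeneousSmooth z f) : IsSymbolAtInfinity z.re f where
  smooth := hf.smooth
  bound L := by
    obtain ⟨C, hC⟩ := (hf.pdIter L).exists_norm_le
    exact ⟨C, fun ξ hξ => by simpa using hC ξ (ne_zero_of_one_lt_norm hξ)⟩

theorem rpow_norm_le_mul_one_add_rpow (p : ℝ) {x : ℝ} (hx : 1 < x) :
    x ^ p ≤ (1 + 2 ^ (-p)) * (1 + x) ^ p := by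
  have hx0 : 0 < x := zero_lt_one.trans hx
  rcases le_total 0 p with hp | hp
  · have h : x ^ p ≤ (1 + x) ^ p := Real.rpow_le_rpow hx0.le (by linarith) hp
    have h2 : 0 ≤ (2 : ℝ) ^ (-p) * (1 + x) ^ p := by positivity
    linarith
  · have h : (2 * x) ^ p ≤ (1 + x) ^ p :=
      Real.rpow_le_rpow_of_nonpos (by linarith) (by linarith) hp
    rw [Real.mul_rpow zero_le_two hx0.le] at h
    have h2 : (2 : ℝ) ^ (-p) * (2 ^ p * x ^ p) ≤ 2 ^ (-p) * (1 + x) ^ p :=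
      mul_le_mul_of_nonneg_left h (by positivity)
    rw [← mul_assoc, ← Real.rpow_add two_pos, neg_add_cancel, Real.rpow_zero, one_mul] at h2
    have h3 : 0 ≤ (1 + x) ^ p := by positivity
    linarith

theorem exists_pos_norm_pdIter_le {f : Euc n → ℂ} (hf : ContDiff ℝ (⊤ : ℕ∞) f) (p : ℝ)
    (L : List (Fin n)) (h : ∃ C : ℝ, ∀ ξ : Euc n, 1 < ‖ξ‖ → ‖pdIter L f ξ‖ ≤ C * ‖ξ‖ ^ p) :
    ∃ C > (0 : ℝ), ∀ ξ : Euc n, ‖pdIter L f ξ‖ ≤ C * (1 + ‖ξ‖) ^ p := by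
  obtain ⟨C, hC⟩ := h
  have hcont : Continuous fun ξ : Euc n => ‖pdIter L f ξ‖ * (1 + ‖ξ‖) ^ (-p) :=
    (contDiff_pdIter hf L).continuous.norm.mul
      ((continuous_const.add continuous_norm).rpow_const fun ξ =>
        Or.inl (by positivity : (1 : ℝ) + ‖ξ‖ ≠ 0))
  obtain ⟨M, hM⟩ := (isCompact_closedBall (0 : Euc n) 1).exists_bound_of_continuousOn
    hcont.continuousOn
  refine ⟨|C| * (1 + 2 ^ (-p)) + |M| + 1, by positivity, fun ξ => ?_⟩
  have hpos : 0 < (1 + ‖ξ‖) ^ p := by positivity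
  rcases le_or_gt ‖ξ‖ 1 with hξ | hξ
  · have h := (le_abs_self _).trans ((hM ξ (by simpa using hξ)).trans (le_abs_self M))
    rw [Real.rpow_neg (by positivity), ← div_eq_mul_inv, div_le_iff₀ hpos] at h
    refine h.trans (mul_le_mul_of_nonneg_right ?_ hpos.le)
    have : 0 ≤ |C| * (1 + 2 ^ (-p)) := by positivity
    linarith
  · calc _ ≤ C * ‖ξ‖ ^ p := hC ξ hξ
      _ ≤ |C| * ((1 + 2 ^ (-p)) * (1 + ‖ξ‖) ^ p) :=
        mul_le_mul (le_abs_self C) (rpow_norm_le_mul_one_add_rpow p hξ) (by positivity)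
          (abs_nonneg C)
      _ = |C| * (1 + 2 ^ (-p)) * (1 + ‖ξ‖) ^ p := by ring
      _ ≤ _ := mul_le_mul_of_nonneg_right (by linarith [abs_nonneg M]) hpos.le

end SymbolsAtInfinity

section RadialIntegrals

variable {n : ℕ}

/-- The integral of `t ^ m * ρ (t • ξ)` over `t ∈ A`. -/
def radialIntegral (A : Set ℝ) (m : ℕ) (ρ : Euc n → ℂ) (ξ : Euc n) : ℂ :=
  ∫ t in A, (t : ℂ) ^ m * ρ (t • ξ)

theorem pdIter_pow_mul_comp_smul {ρ : Euc n → ℂ} (hρ : ContDiff ℝ (⊤ : ℕ∞) ρ) (m : ℕ) (t : ℝ)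
    (L : List (Fin n)) (ξ : Euc n) :
    pdIter L (fun η => (t : ℂ) ^ m * ρ (t • η)) ξ =
      (t : ℂ) ^ (m + L.length) * pdIter L ρ (t • ξ) := by
  have h := congrFun (pdIter_const_mul_comp_affine hρ ((t : ℂ) ^ m) t 0 L) ξ
  simpa only [sub_zero, pow_add] using h

theorem isDominatedFamily_radial {A : Set ℝ} {m : ℕ} {ρ : Euc n → ℂ}
    (hρ : ContDiff ℝ (⊤ : ℕ∞) ρ)
    (h : ∀ (L : List (Fin n)) (ξ : Euc n), ξ ≠ 0 → ∃ b : ℝ → ℝ, IntegrableOn b A ∧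
      ∀ᵐ t : ℝ ∂volume.restrict A, ∀ η : Euc n, ‖ξ‖ / 2 < ‖η‖ →
        ‖(t : ℂ) ^ (m + L.length) * pdIter L ρ (t • η)‖ ≤ b t) :
    IsDominatedFamily (volume.restrict A) {(0 : Euc n)}ᶜ
      (fun (t : ℝ) ξ => (t : ℂ) ^ m * ρ (t • ξ)) where
  smooth t := contDiff_const.mul (hρ.comp (contDiff_const_smul t))
  meas L ξ _ := by
    simp_rw [pdIter_pow_mul_comp_smul hρ]
    refine Continuous.aestronglyMeasurable ?_
    have := (contDiff_pdIter hρ L).continuous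
    fun_prop
  dom L ξ hξ := by
    obtain ⟨b, hb, hbt⟩ := h L ξ hξ
    refine ⟨b, hb, {η | ‖ξ‖ / 2 < ‖η‖}, ?_, ?_⟩
    · exact (isOpen_lt continuous_const continuous_norm).mem_nhds
        (half_lt_self (norm_pos_iff.2 hξ))
    · filter_upwards [hbt] with t ht η hη
      rw [pdIter_pow_mul_comp_smul hρ]
      exact ht η hη

theorem pd_radialIntegral {A : Set ℝ} {m : ℕ} {ρ : Euc n → ℂ} (hρ : ContDiff ℝ (⊤ : ℕ∞) ρ)
    (h : IsDominatedFamily (volume.restrict A) {(0 : Euc n)}ᶜ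
      (fun (t : ℝ) ξ => (t : ℂ) ^ m * ρ (t • ξ))) (i : Fin n) {ξ : Euc n} (hξ : ξ ≠ 0) :
    pd i (radialIntegral A m ρ) ξ = radialIntegral A (m + 1) (pd i ρ) ξ := by
  refine (h.pd_integral isOpen_compl_singleton i hξ).trans ?_
  have : ∀ t : ℝ, pd i (fun η => (t : ℂ) ^ m * ρ (t • η)) ξ =
      (t : ℂ) ^ (m + 1) * pd i ρ (t • ξ) := fun t => pdIter_pow_mul_comp_smul hρ m t [i] ξ
  simp_rw [this]
  rfl

theorem integrableOn_radial {A : Set ℝ} {m : ℕ} {ρ : Euc n → ℂ} (hρ : ContDiff ℝ (⊤ : ℕ∞) ρ)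
    (h : IsDominatedFamily (volume.restrict A) {(0 : Euc n)}ᶜ
      (fun (t : ℝ) ξ => (t : ℂ) ^ m * ρ (t • ξ))) (i : Fin n) {ξ : Euc n} (hξ : ξ ≠ 0) :
    IntegrableOn (fun t : ℝ => (t : ℂ) ^ (m + 1) * pd i ρ (t • ξ)) A := by
  have := h.integrable [i] hξ
  simp_rw [pdIter_pow_mul_comp_smul hρ] at this
  exact this

/-- Smooth functions satisfying the global symbol estimates of real order `r`. -/
structure IsSymbol (r : ℝ) (ρ : Euc n → ℂ) : Prop where
  smooth : ContDiff ℝ (⊤ : ℕ∞) ρ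
  bound : ∀ L : List (Fin n), ∃ C > (0 : ℝ), ∀ ξ : Euc n,
    ‖pdIter L ρ ξ‖ ≤ C * (1 + ‖ξ‖) ^ (r - L.length)

namespace IsSymbol

variable {r : ℝ} {ρ : Euc n → ℂ}

theorem exists_norm_pow_mul_le (hρ : IsSymbol r ρ) (hr : r ≤ 0) (m : ℕ) (L : List (Fin n)) :
    ∃ C > (0 : ℝ), ∀ t : ℝ, 0 < t → ∀ ξ : Euc n, ∀ δ : ℝ, 0 < δ → δ ≤ ‖ξ‖ →
      ‖(t : ℂ) ^ (m + L.length) * pdIter L ρ (t • ξ)‖ ≤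
        C * δ ^ (r - L.length) * t ^ ((m : ℝ) + r) := by
  obtain ⟨C, hC, h⟩ := hρ.bound L
  refine ⟨C, hC, fun t ht ξ δ hδ hδξ => ?_⟩
  have hq : r - L.length ≤ 0 := by
    have : (0 : ℝ) ≤ L.length := Nat.cast_nonneg _
    linarith
  have hle : t * δ ≤ 1 + ‖t • ξ‖ := by
    rw [norm_smul, Real.norm_of_nonneg ht.le]
    have := mul_le_mul_of_nonneg_left hδξ ht.le
    linarith
  have h1 : (1 + ‖t • ξ‖) ^ (r - L.length) ≤ (t * δ) ^ (r - L.length) :=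
    Real.rpow_le_rpow_of_nonpos (by positivity) hle hq
  have h2 : (t : ℝ) ^ ((m : ℝ) + r) = t ^ (m + L.length) * t ^ (r - L.length) := by
    rw [← Real.rpow_natCast, ← Real.rpow_add ht]
    congr 1
    push_cast
    ring
  rw [norm_mul, norm_pow, norm_real, Real.norm_of_nonneg ht.le, h2]
  calc t ^ (m + L.length) * ‖pdIter L ρ (t • ξ)‖
      ≤ t ^ (m + L.length) * (C * (t * δ) ^ (r - L.length)) := by
        gcongr
        exact (h _).trans (by gcongr)
    _ = _ := by
        rw [Real.mul_rpow ht.le hδ.le]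
        ring

theorem isDominatedFamily (hρ : IsSymbol r ρ) (hr : r ≤ 0) {m : ℕ} (hm : m + r < -1) :
    IsDominatedFamily (volume.restrict (Set.Ioi 1)) {(0 : Euc n)}ᶜ
      (fun (t : ℝ) ξ => (t : ℂ) ^ m * ρ (t • ξ)) := by
  refine isDominatedFamily_radial hρ.smooth fun L ξ hξ => ?_
  obtain ⟨C, -, h⟩ := hρ.exists_norm_pow_mul_le hr m L
  refine ⟨fun t => C * (‖ξ‖ / 2) ^ (r - L.length) * t ^ ((m : ℝ) + r),
    (integrableOn_Ioi_rpow_of_lt hm zero_lt_one).const_mul _, ?_⟩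
  filter_upwards [ae_restrict_mem measurableSet_Ioi] with t ht η hη
  exact h t (zero_lt_one.trans ht) η _ (half_pos (norm_pos_iff.2 hξ)) hη.le

theorem isSymbolAtInfinity_radialIntegral (hρ : IsSymbol r ρ) (hr : r ≤ 0) {m : ℕ}
    (hm : m + r < -1) : IsSymbolAtInfinity r (radialIntegral (Set.Ioi 1) m ρ) where
  smooth := (hρ.isDominatedFamily hr hm).contDiffOn isOpen_compl_singleton
  bound L := by
    obtain ⟨C, -, h⟩ := hρ.exists_norm_pow_mul_le hr m L
    refine ⟨C * ∫ t in Set.Ioi (1 : ℝ), t ^ ((m : ℝ) + r), fun ξ hξ => ?_⟩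
    have hξ0 := ne_zero_of_one_lt_norm hξ
    have heq : pdIter L (radialIntegral (Set.Ioi 1) m ρ) ξ =
        ∫ t in Set.Ioi (1 : ℝ), (t : ℂ) ^ (m + L.length) * pdIter L ρ (t • ξ) := by
      refine ((hρ.isDominatedFamily hr hm).pdIter_integral isOpen_compl_singleton L hξ0).trans ?_
      simp_rw [pdIter_pow_mul_comp_smul hρ.smooth]
    have hb : ∀ᵐ t : ℝ ∂volume.restrict (Set.Ioi (1 : ℝ)),
        ‖(t : ℂ) ^ (m + L.length) * pdIter L ρ (t • ξ)‖ ≤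
          C * ‖ξ‖ ^ (r - L.length) * t ^ ((m : ℝ) + r) := by
      filter_upwards [ae_restrict_mem measurableSet_Ioi] with t ht
      exact h t (zero_lt_one.trans ht) ξ _ (norm_pos_iff.2 hξ0) le_rfl
    rw [heq]
    refine (norm_integral_le_of_norm_le
      ((integrableOn_Ioi_rpow_of_lt hm zero_lt_one).const_mul _) hb).trans (le_of_eq ?_)
    rw [integral_const_mul]
    ring

theorem divergence_coord_mul_radialIntegral (hρ : IsSymbol r ρ) {m : ℕ} (hmn : m + 1 = n)
    (hr : r < -n) {ξ : Euc n} (hξ : ξ ≠ 0) :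
    ∑ i, pd i (fun η => (η i : ℂ) * radialIntegral (Set.Ioi 1) m ρ η) ξ = -ρ ξ := by
  have hmn' : (m : ℝ) + 1 = n := by exact_mod_cast hmn
  have hr0 : r ≤ 0 := by
    have : (0 : ℝ) ≤ n := Nat.cast_nonneg _
    linarith
  have hdom := hρ.isDominatedFamily hr0 (m := m) (by linarith)
  have hG := (hρ.isSymbolAtInfinity_radialIntegral hr0 (m := m) (by linarith)).smooth
  have hterm : ∀ i, pd i (fun η => (η i : ℂ) * radialIntegral (Set.Ioi 1) m ρ η) ξ =
      radialIntegral (Set.Ioi 1) m ρ ξ +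
        ∫ t in Set.Ioi (1 : ℝ), (ξ i : ℂ) * ((t : ℂ) ^ (m + 1) * pd i ρ (t • ξ)) := fun i => by
    rw [pd_mul ((contDiff_coord i).differentiable (by simp) ξ)
      (differentiableAt_of_contDiffOn isOpen_compl_singleton hG hξ), pd_coord, if_pos rfl,
      one_mul, pd_radialIntegral hρ.smooth hdom i hξ, integral_const_mul]
    rfl
  have hint : ∀ i, IntegrableOn
      (fun t : ℝ => (ξ i : ℂ) * ((t : ℂ) ^ (m + 1) * pd i ρ (t • ξ))) (Set.Ioi 1) := fun i =>
    (integrableOn_radial hρ.smooth hdom i hξ).const_mul _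
  have hint0 : IntegrableOn (fun t : ℝ => (n : ℂ) * ((t : ℂ) ^ m * ρ (t • ξ))) (Set.Ioi 1) :=
    (hdom.integrable [] hξ).const_mul _
  have hderiv : ∀ t ∈ Set.Ici (1 : ℝ), HasDerivAt (fun t : ℝ => (t : ℂ) ^ (m + 1) * ρ (t • ξ))
      ((n : ℂ) * ((t : ℂ) ^ m * ρ (t • ξ)) +
        ∑ i, (ξ i : ℂ) * ((t : ℂ) ^ (m + 1) * pd i ρ (t • ξ))) t := fun t _ => by
    have ha : HasDerivAt (fun t : ℝ => t • ξ) ξ t := by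
      simpa using (hasDerivAt_id t).smul_const ξ
    have hb : HasDerivAt (fun t : ℝ => ρ (t • ξ)) (fderiv ℝ ρ (t • ξ) ξ) t :=
      (hρ.smooth.differentiable (by simp) (t • ξ)).hasFDerivAt.comp_hasDerivAt t ha
    have hc : HasDerivAt (fun t : ℝ => (t : ℂ) ^ (m + 1)) (((m + 1 : ℕ) : ℂ) * (t : ℂ) ^ m) t := by
      simpa using (hasDerivAt_pow (m + 1) (t : ℂ)).comp_ofReal
    refine (hc.mul hb).congr_deriv ?_
    rw [fderiv_apply_eq_sum_pd, Finset.mul_sum, hmn, mul_assoc]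
    refine congrArg₂ _ rfl (Finset.sum_congr rfl fun i _ => by ring)
  have htend : Tendsto (fun t : ℝ => (t : ℂ) ^ (m + 1) * ρ (t • ξ)) atTop (𝓝 0) := by
    obtain ⟨C, -, h⟩ := hρ.exists_norm_pow_mul_le hr0 (m + 1) []
    have hlim := (tendsto_rpow_neg_atTop (y := -((m + 1 : ℕ) + r))
      (by push_cast; linarith)).const_mul (C * ‖ξ‖ ^ (r - (0 : ℕ)))
    rw [mul_zero] at hlim
    refine squeeze_zero_norm' ?_ hlim
    filter_upwards [eventually_gt_atTop 0] with t ht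
    simpa [pdIter] using h t ht ξ _ (norm_pos_iff.2 hξ) le_rfl
  have hsum := integrable_finsetSum (μ := volume.restrict (Set.Ioi (1 : ℝ)))
    (f := fun i t => (ξ i : ℂ) * ((t : ℂ) ^ (m + 1) * pd i ρ (t • ξ)))
    Finset.univ fun i _ => hint i
  have hftc := integral_Ioi_of_hasDerivAt_of_tendsto' hderiv (hint0.add hsum) htend
  rw [integral_add hint0 hsum, integral_finsetSum _ fun i _ => hint i, integral_const_mul] at hftc
  simp_rw [hterm]
  rw [Finset.sum_add_distrib, Finset.sum_const, Finset.card_univ, Fintype.card_fin,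
    nsmul_eq_mul]
  simpa [radialIntegral] using hftc

theorem radialIntegral_sub_of_eq_homogeneous {r' : ℝ} {ρ' : Euc n → ℂ} (hρ : IsSymbol r ρ)
    (hρ' : IsSymbol r' ρ') {m : ℕ} (hmn : m + 1 = n) (hr : r < -n) (hr' : r' < -n) {z : ℂ}
    {f : Euc n → ℂ} (hf : IsHomogeneousSmooth z f) (hz : z.re < -n)
    (h : ∀ ξ, 1 < ‖ξ‖ → ρ ξ - ρ' ξ = f ξ) {ξ : Euc n} (hξ : 1 < ‖ξ‖) :
    radialIntegral (Set.Ioi 1) m ρ ξ - radialIntegral (Set.Ioi 1) m ρ' ξ =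
      -((z + n)⁻¹ * f ξ) := by
  have hmn' : (m : ℝ) + 1 = n := by exact_mod_cast hmn
  have hmn'' : (m : ℂ) + 1 = n := by exact_mod_cast hmn
  have hn : (0 : ℝ) ≤ n := Nat.cast_nonneg _
  have hξ0 := ne_zero_of_one_lt_norm hξ
  have hi : IntegrableOn (fun t : ℝ => (t : ℂ) ^ m * ρ (t • ξ)) (Set.Ioi 1) :=
    (hρ.isDominatedFamily (by linarith) (m := m) (by linarith)).integrable [] hξ0
  have hi' : IntegrableOn (fun t : ℝ => (t : ℂ) ^ m * ρ' (t • ξ)) (Set.Ioi 1) :=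
    (hρ'.isDominatedFamily (by linarith) (m := m) (by linarith)).integrable [] hξ0
  have hre : (z + m).re < -1 := by
    simp only [add_re, natCast_re]
    linarith
  have hexp : z + m + 1 = z + n := by rw [← hmn'']; ring
  simp only [radialIntegral]
  rw [← integral_sub hi hi']
  have hcongr : Set.EqOn (fun t : ℝ => (t : ℂ) ^ m * ρ (t • ξ) - (t : ℂ) ^ m * ρ' (t • ξ))
      (fun t : ℝ => (t : ℂ) ^ (z + m) * f ξ) (Set.Ioi 1) := fun t ht => by
    have ht1 : (1 : ℝ) < t := ht
    have ht0 : (0 : ℝ) < t := zero_lt_one.trans ht1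
    have hnorm : 1 < ‖t • ξ‖ := by
      rw [norm_smul, Real.norm_of_nonneg ht0.le]
      exact one_lt_mul_of_lt_of_le ht1 hξ.le
    simp only
    rw [← mul_sub, h _ hnorm, hf.homog t ht0 ξ hξ0, cpow_add _ _ (ofReal_ne_zero.2 ht0.ne'),
      cpow_natCast]
    ring
  rw [setIntegral_congr_fun measurableSet_Ioi hcongr, integral_mul_const,
    integral_Ioi_cpow_of_lt hre zero_lt_one, hexp]
  simp
  ring

end IsSymbol

section CompactSupport

variable {W : Euc n → ℂ}

theorem pdIter_eq_zero_of_lt_norm {R : ℝ} (hW : ∀ x, R < ‖x‖ → W x = 0) (L : List (Fin n))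
    {x : Euc n} (hx : R < ‖x‖) : pdIter L W x = 0 := by
  rw [pdIter_congr (g := fun _ => 0) (isOpen_lt continuous_const continuous_norm)
    (fun y hy => hW y hy) L hx, pdIter_zero]

theorem exists_norm_pdIter_le_of_support (hs : ContDiff ℝ (⊤ : ℕ∞) W) {R : ℝ}
    (hW : ∀ x, R < ‖x‖ → W x = 0) (L : List (Fin n)) :
    ∃ M : ℝ, 0 ≤ M ∧ ∀ x, ‖pdIter L W x‖ ≤ M := by
  obtain ⟨M, hM⟩ := (isCompact_closedBall (0 : Euc n) R).exists_bound_of_continuousOn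
    (contDiff_pdIter hs L).continuous.continuousOn
  refine ⟨|M|, abs_nonneg M, fun x => ?_⟩
  rcases le_or_gt ‖x‖ R with hx | hx
  · exact (hM x (by simpa using hx)).trans (le_abs_self M)
  · simp [pdIter_eq_zero_of_lt_norm hW L hx]

theorem isDominatedFamily_radial_of_support (hs : ContDiff ℝ (⊤ : ℕ∞) W) {R : ℝ}
    (hW : ∀ x, R < ‖x‖ → W x = 0) (m : ℕ) :
    IsDominatedFamily (volume.restrict (Set.Ioi 0)) {(0 : Euc n)}ᶜ
      (fun (t : ℝ) ξ => (t : ℂ) ^ m * W (t • ξ)) := by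
  refine isDominatedFamily_radial hs fun L ξ hξ => ?_
  obtain ⟨M, hM0, hM⟩ := exists_norm_pdIter_le_of_support hs hW L
  have hδ : 0 < ‖ξ‖ / 2 := half_pos (norm_pos_iff.2 hξ)
  set B := R / (‖ξ‖ / 2) with hB
  refine ⟨(Set.Icc 0 B).indicator fun _ => B ^ (m + L.length) * M, ?_, ?_⟩
  · refine Integrable.integrableOn ?_
    rw [integrable_indicator_iff measurableSet_Icc]
    exact integrableOn_const (by simp)
  · filter_upwards [ae_restrict_mem measurableSet_Ioi] with t ht η hη
    have ht0 : (0 : ℝ) < t := ht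
    by_cases htB : t ≤ B
    · rw [Set.indicator_of_mem (show t ∈ Set.Icc 0 B from ⟨ht0.le, htB⟩), norm_mul, norm_pow,
        norm_real, Real.norm_of_nonneg ht0.le]
      have hB0 : 0 ≤ B := ht0.le.trans htB
      gcongr
      exact hM _
    · have hR : R < ‖t • η‖ := by
        rw [norm_smul, Real.norm_of_nonneg ht0.le]
        rw [not_le, hB, div_lt_iff₀ hδ] at htB
        exact htB.trans (mul_lt_mul_of_pos_left hη ht0)
      rw [Set.indicator_of_notMem (fun h => htB h.2), pdIter_eq_zero_of_lt_norm hW L hR]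
      simp

theorem isHomogeneousSmooth_radialIntegral (hs : ContDiff ℝ (⊤ : ℕ∞) W) {R : ℝ}
    (hW : ∀ x, R < ‖x‖ → W x = 0) (m : ℕ) :
    IsHomogeneousSmooth (-((m : ℂ) + 1)) (radialIntegral (Set.Ioi 0) m W) where
  smooth := (isDominatedFamily_radial_of_support hs hW m).contDiffOn isOpen_compl_singleton
  homog s hpos ξ _ := by
    have hs0 : (s : ℂ) ≠ 0 := ofReal_ne_zero.2 hpos.ne'
    have h := integral_comp_mul_right_Ioi (fun t : ℝ => (t : ℂ) ^ m * W (t • ξ)) 0 hpos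
    rw [zero_mul] at h
    have h2 : ∀ t : ℝ, ((t * s : ℝ) : ℂ) ^ m * W ((t * s) • ξ) =
        (s : ℂ) ^ m * ((t : ℂ) ^ m * W (t • s • ξ)) := fun t => by
      rw [smul_smul]
      push_cast
      ring
    simp_rw [h2] at h
    rw [integral_const_mul] at h
    simp only [radialIntegral]
    rw [cpow_neg, ← Nat.cast_succ, cpow_natCast, pow_succ, mul_inv]
    rw [real_smul, ofReal_inv] at h
    rw [mul_assoc, ← h, ← mul_assoc, inv_mul_cancel₀ (pow_ne_zero _ hs0), one_mul]

end CompactSupport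

end RadialIntegrals

section CompactPoincare

variable {n : ℕ} {F θ : Euc n → ℂ} {R : ℝ}

theorem integrable_of_support (hF : Continuous F) (hFR : ∀ x, R < ‖x‖ → F x = 0) :
    Integrable F :=
  hF.integrable_of_hasCompactSupport <|
    HasCompactSupport.intro (isCompact_closedBall (0 : Euc n) R) fun x hx =>
      hFR x (by simpa using hx)

/-- The average over `v` and `0 < s ≤ 1` of the translates by `s • v` of the vector field
`v * F`, with weight `θ`. -/
def translationPotential (F θ : Euc n → ℂ) (i : Fin n) (x : Euc n) : ℂ :=
  ∫ p : Euc n × ℝ, (p.1 i : ℂ) * θ p.1 * F (x - p.2 • p.1)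
    ∂((volume : Measure (Euc n)).prod (volume.restrict (Set.Ioc 0 1)))

theorem pdIter_mul_comp_sub (hF : ContDiff ℝ (⊤ : ℕ∞) F) (c : ℂ) (w : Euc n) (L : List (Fin n)) :
    pdIter L (fun x => c * F (x - w)) = fun x => c * pdIter L F (x - w) := by
  simpa using pdIter_const_mul_comp_affine hF c 1 w L

theorem isDominatedFamily_translation (hF : ContDiff ℝ (⊤ : ℕ∞) F) (hθ : Continuous θ)
    (hFR : ∀ x, R < ‖x‖ → F x = 0) (hθR : ∀ x, R < ‖x‖ → θ x = 0) (i : Fin n) :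
    IsDominatedFamily ((volume : Measure (Euc n)).prod (volume.restrict (Set.Ioc (0 : ℝ) 1)))
      Set.univ (fun p x => (p.1 i : ℂ) * θ p.1 * F (x - p.2 • p.1)) where
  smooth p := contDiff_const.mul (hF.comp (contDiff_id.sub contDiff_const))
  meas L x _ := by
    simp_rw [pdIter_mul_comp_sub hF]
    refine Continuous.aestronglyMeasurable ?_
    have h1 := (contDiff_pdIter hF L).continuous
    have h2 := (contDiff_coord i).continuous
    fun_prop
  dom L x _ := by
    obtain ⟨M, hM0, hM⟩ := exists_norm_pdIter_le_of_support hF hFR L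
    have hint : Integrable fun v : Euc n => (v i : ℂ) * θ v :=
      integrable_of_support ((contDiff_coord i).continuous.mul hθ) fun v hv => by
        rw [hθR v hv, mul_zero]
    refine ⟨fun p => ‖(p.1 i : ℂ) * θ p.1‖ * M,
      hint.norm.mul_prod (integrable_const M), Set.univ, univ_mem,
      Eventually.of_forall fun p y _ => ?_⟩
    rw [pdIter_mul_comp_sub hF, norm_mul]
    exact mul_le_mul_of_nonneg_left (hM _) (norm_nonneg _)

theorem contDiff_translationPotential (hF : ContDiff ℝ (⊤ : ℕ∞) F) (hθ : Continuous θ)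
    (hFR : ∀ x, R < ‖x‖ → F x = 0) (hθR : ∀ x, R < ‖x‖ → θ x = 0) (i : Fin n) :
    ContDiff ℝ (⊤ : ℕ∞) (translationPotential F θ i) :=
  contDiffOn_univ.1 ((isDominatedFamily_translation hF hθ hFR hθR i).contDiffOn isOpen_univ)

theorem translationPotential_eq_zero (hFR : ∀ x, R < ‖x‖ → F x = 0)
    (hθR : ∀ x, R < ‖x‖ → θ x = 0) (i : Fin n) {x : Euc n} (hx : 2 * R < ‖x‖) :
    translationPotential F θ i x = 0 := by
  have hmem : ∀ᵐ p ∂((volume : Measure (Euc n)).prod (volume.restrict (Set.Ioc (0 : ℝ) 1))),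
      p.2 ∈ Set.Ioc (0 : ℝ) 1 :=
    Measure.quasiMeasurePreserving_snd.ae (ae_restrict_mem measurableSet_Ioc)
  refine integral_eq_zero_of_ae ?_
  filter_upwards [hmem] with p hp
  rcases lt_or_ge R ‖p.1‖ with h | h
  · simp [hθR _ h]
  · have h1 : ‖p.2 • p.1‖ ≤ R := by
      rw [norm_smul, Real.norm_of_nonneg hp.1.le]
      exact (mul_le_of_le_one_left (norm_nonneg _) hp.2).trans h
    have h2 : R < ‖x - p.2 • p.1‖ := by
      have := norm_sub_norm_le x (p.2 • p.1)
      linarith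
    simp [hFR _ h2]

theorem sum_pd_translationPotential (hF : ContDiff ℝ (⊤ : ℕ∞) F) (hθ : Continuous θ)
    (hFR : ∀ x, R < ‖x‖ → F x = 0) (hθR : ∀ x, R < ‖x‖ → θ x = 0) (x : Euc n) :
    ∑ i, pd i (translationPotential F θ i) x =
      F x * (∫ v, θ v) - ∫ v, θ v * F (x - v) := by
  have hdom := isDominatedFamily_translation hF hθ hFR hθR
  have hint : ∀ i, Integrable (fun p : Euc n × ℝ => (p.1 i : ℂ) * θ p.1 * pd i F (x - p.2 • p.1))
      ((volume : Measure (Euc n)).prod (volume.restrict (Set.Ioc (0 : ℝ) 1))) := fun i => by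
    have := (hdom i).integrable [i] (Set.mem_univ x)
    simp_rw [pdIter_mul_comp_sub hF] at this
    exact this
  have hpd : ∀ i, pd i (translationPotential F θ i) x =
      ∫ p : Euc n × ℝ, (p.1 i : ℂ) * θ p.1 * pd i F (x - p.2 • p.1)
        ∂((volume : Measure (Euc n)).prod (volume.restrict (Set.Ioc 0 1))) := fun i => by
    refine ((hdom i).pd_integral isOpen_univ i (Set.mem_univ x)).trans ?_
    refine integral_congr_ae (Eventually.of_forall fun p => ?_)
    exact congrFun (pdIter_mul_comp_sub hF _ _ [i]) x
  have hinner : ∀ v : Euc n, ∫ s in Set.Ioc (0 : ℝ) 1,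
      ∑ i, (v i : ℂ) * θ v * pd i F (x - s • v) = F x * θ v - θ v * F (x - v) := fun v => by
    have hderiv : ∀ s : ℝ, HasDerivAt (fun s : ℝ => -(θ v * F (x - s • v)))
        (∑ i, (v i : ℂ) * θ v * pd i F (x - s • v)) s := fun s => by
      have ha : HasDerivAt (fun s : ℝ => x - s • v) (-v) s := by
        simpa using ((hasDerivAt_id s).smul_const v).const_sub x
      have hb : HasDerivAt (fun s : ℝ => F (x - s • v)) (fderiv ℝ F (x - s • v) (-v)) s :=
        (hF.differentiable (by simp) (x - s • v)).hasFDerivAt.comp_hasDerivAt s ha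
      refine (hb.const_mul (θ v)).neg.congr_deriv ?_
      rw [map_neg, mul_neg, neg_neg, fderiv_apply_eq_sum_pd, Finset.mul_sum]
      exact Finset.sum_congr rfl fun i _ => by ring
    have hcont : Continuous fun s : ℝ => ∑ i, (v i : ℂ) * θ v * pd i F (x - s • v) := by
      have := fun i => (contDiff_pd hF i).continuous
      fun_prop
    rw [← intervalIntegral.integral_of_le zero_le_one,
      intervalIntegral.integral_eq_sub_of_hasDerivAt (fun s _ => hderiv s)
        (hcont.intervalIntegrable _ _)]
    simp
    ring
  have hθi : Integrable θ := integrable_of_support hθ hθR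
  have hconv : Integrable fun v => θ v * F (x - v) :=
    integrable_of_support (hθ.mul (hF.continuous.comp (continuous_const.sub continuous_id)))
      fun v hv => by rw [hθR v hv, zero_mul]
  simp_rw [hpd]
  rw [← integral_finsetSum _ fun i _ => hint i, integral_prod _ (integrable_finsetSum
    (f := fun i (p : Euc n × ℝ) => (p.1 i : ℂ) * θ p.1 * pd i F (x - p.2 • p.1)) _
    fun i _ => hint i)]
  simp_rw [hinner]
  rw [integral_sub (hθi.const_mul _) hconv, integral_const_mul]

/-- A compactly supported smooth function with vanishing integral is the divergence of a
compactly supported smooth vector field. -/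
theorem exists_divergence_eq_of_integral_eq_zero (hF : ContDiff ℝ (⊤ : ℕ∞) F)
    (hFR : ∀ x, R < ‖x‖ → F x = 0) (hF0 : ∫ x, F x = 0) :
    ∃ (S : ℝ) (W : Fin n → Euc n → ℂ), (∀ i, ContDiff ℝ (⊤ : ℕ∞) (W i)) ∧
      (∀ i x, S < ‖x‖ → W i x = 0) ∧ ∀ x, ∑ i, pd i (W i) x = F x := by
  let φ : ContDiffBump (0 : Euc n) := ⟨1, 2, one_pos, one_lt_two⟩
  let θ : Euc n → ℂ := fun x => (φ.normed volume x : ℂ)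
  have hθ : ContDiff ℝ (⊤ : ℕ∞) θ := ofRealCLM.contDiff.comp φ.contDiff_normed
  have hθ1 : ∫ x, θ x = 1 := by
    rw [integral_complex_ofReal, φ.integral_normed, ofReal_one]
  set S := max R 2
  have hFS : ∀ x, S < ‖x‖ → F x = 0 := fun x hx => hFR x ((le_max_left _ _).trans_lt hx)
  have hθS : ∀ x, S < ‖x‖ → θ x = 0 := fun x hx => by
    have : x ∉ Function.support (φ.normed volume) := by
      rw [φ.support_normed_eq]
      simpa using ((le_max_right _ _).trans_lt hx).le
    simpa [θ] using this
  have h1 := contDiff_translationPotential hF hθ.continuous hFS hθS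
  have h2 := contDiff_translationPotential hθ hF.continuous hθS hFS
  refine ⟨2 * S, fun i x => translationPotential F θ i x - translationPotential θ F i x,
    fun i => (h1 i).sub (h2 i), fun i x hx => ?_, fun x => ?_⟩
  · simp only [translationPotential_eq_zero hFS hθS i hx,
      translationPotential_eq_zero hθS hFS i hx, sub_zero]
  · have hcomm : ∫ v, F v * θ (x - v) = ∫ v, θ v * F (x - v) := by
      rw [← integral_sub_left_eq_self (fun v => θ v * F (x - v)) volume x]
      refine integral_congr_ae (Eventually.of_forall fun v => ?_)
      simp only [sub_sub_cancel]
      exact mul_comm _ _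
    simp_rw [pd_sub ((h1 _).differentiable (by simp) x) ((h2 _).differentiable (by simp) x)]
    rw [Finset.sum_sub_distrib, sum_pd_translationPotential hF hθ.continuous hFS hθS,
      sum_pd_translationPotential hθ hF.continuous hθS hFS, hcomm, hθ1, hF0]
    ring

end CompactPoincare

section HomogeneousDivergence

variable {n : ℕ} {z : ℂ} {f : Euc n → ℂ}

theorem integral_homogeneous_mul_radial_eq_zero [Nontrivial (Euc n)]
    (hf : IsHomogeneousSmooth z f) (hint : sphInt f = 0) (g : ℝ → ℂ) : ∫ x, f x * g ‖x‖ = 0 := by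
  calc ∫ x, f x * g ‖x‖
      = ∫ x : ({(0 : Euc n)}ᶜ : Set (Euc n)), f x * g ‖x.1‖ ∂(volume.comap Subtype.val) := by
        rw [integral_subtype_comap (measurableSet_singleton _).compl fun x => f x * g ‖x‖,
          restrict_compl_singleton]
    _ = ∫ p : sphere (0 : Euc n) 1 × Set.Ioi (0 : ℝ), f p.1 * ((p.2 : ℂ) ^ z * g p.2)
          ∂(volume : Measure (Euc n)).toSphere.prod
            (.volumeIoiPow (Module.finrank ℝ (Euc n) - 1)) := by
        rw [← (volume : Measure (Euc n)).measurePreserving_homeomorphUnitSphereProd.integral_comp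
          (Homeomorph.measurableEmbedding _)]
        refine integral_congr_ae (Eventually.of_forall fun x => ?_)
        have hx : x.1 ≠ 0 := x.2
        have hpos : 0 < ‖x.1‖ := norm_pos_iff.2 hx
        have h := hf.homog ‖x.1‖ hpos (‖x.1‖⁻¹ • x.1) (smul_ne_zero (inv_ne_zero hpos.ne') hx)
        rw [smul_inv_smul₀ hpos.ne'] at h
        simp only [homeomorphUnitSphereProd_apply_fst_coe, homeomorphUnitSphereProd_apply_snd_coe]
        rw [h]
        ring
    _ = sphInt f * ∫ r : Set.Ioi (0 : ℝ), (r : ℂ) ^ z * g r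
          ∂(.volumeIoiPow (Module.finrank ℝ (Euc n) - 1)) :=
        integral_prod_mul (fun ω : sphere (0 : Euc n) 1 => f ω)
          (fun r : Set.Ioi (0 : ℝ) => (r : ℂ) ^ z * g r)
    _ = 0 := by rw [hint, zero_mul]

/-- A homogeneous function of degree `-n` whose integral over the sphere vanishes is the
divergence of a homogeneous vector field of degree `1 - n`. -/
theorem exists_homogeneous_divergence (hn : 2 ≤ n) (hf : IsHomogeneousSmooth (-n) f)
    (hint : sphInt f = 0) :
    ∃ V : Fin n → Euc n → ℂ, (∀ i, IsHomogeneousSmooth (1 - n) (V i)) ∧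
      ∀ ξ, ξ ≠ 0 → ∑ i, pd i (V i) ξ = f ξ := by
  obtain ⟨m, rfl⟩ : ∃ m, n = m + 2 := ⟨n - 2, by omega⟩
  let φ : ContDiffBump (2 : ℝ) := ⟨1 / 2, 1, by norm_num, by norm_num⟩
  let g : ℝ → ℝ := φ.normed volume
  have hg0 : ∀ r, r ≤ 1 ∨ 3 ≤ r → g r = 0 := fun r hr => by
    have : r ∉ Function.support g := by
      rw [φ.support_normed_eq]
      simp only [φ, mem_ball, Real.dist_eq, not_lt]
      rcases hr with hr | hr
      · rw [abs_of_nonpos (by linarith)]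
        linarith
      · rw [abs_of_nonneg (by linarith)]
        linarith
    simpa using this
  let F : Euc (m + 2) → ℂ := fun x => f x * ((‖x‖ * g ‖x‖ : ℝ) : ℂ)
  have hF : ContDiff ℝ (⊤ : ℕ∞) F := by
    rw [contDiff_iff_contDiffAt]
    intro x
    rcases eq_or_ne x 0 with rfl | hx
    · refine (contDiffAt_const (c := 0)).congr_of_eventuallyEq ?_
      filter_upwards [ball_mem_nhds (0 : Euc (m + 2)) one_pos] with y hy
      rw [mem_ball_zero_iff] at hy
      simp [F, hg0 _ (Or.inl hy.le)]
    · have h1 := contDiffAt_norm ℝ hx (n := (⊤ : ℕ∞))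
      refine (hf.smooth.contDiffAt (isOpen_compl_singleton.mem_nhds hx)).mul ?_
      exact ofRealCLM.contDiff.contDiffAt.comp x
        (h1.mul (φ.contDiff_normed.contDiffAt.comp x h1))
  have hF3 : ∀ x, 3 < ‖x‖ → F x = 0 := fun x hx => by simp [F, hg0 _ (Or.inr hx.le)]
  obtain ⟨S, W, hW, hWS, hdiv⟩ := exists_divergence_eq_of_integral_eq_zero hF hF3
    (integral_homogeneous_mul_radial_eq_zero hf hint fun r => ((r * g r : ℝ) : ℂ))
  refine ⟨fun i => radialIntegral (Set.Ioi 0) m (W i), fun i => ?_, fun ξ hξ => ?_⟩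
  · have h := isHomogeneousSmooth_radialIntegral (hW i) (hWS i) m
    convert h using 1
    push_cast
    ring
  · have hpos : 0 < ‖ξ‖ := norm_pos_iff.2 hξ
    have hdom := fun i => isDominatedFamily_radial_of_support (hW i) (hWS i) m
    have hgint : ∫ t in Set.Ioi (0 : ℝ), g (t * ‖ξ‖) = ‖ξ‖⁻¹ := by
      have h := setIntegral_eq_integral_of_forall_compl_eq_zero (μ := volume)
        (s := Set.Ioi (0 : ℝ)) (f := g) fun r hr => hg0 r (Or.inl ((not_lt.1 hr).trans zero_le_one))
      rw [integral_comp_mul_right_Ioi g 0 hpos, zero_mul, h, φ.integral_normed, smul_eq_mul,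
        mul_one]
    calc ∑ i, pd i (radialIntegral (Set.Ioi 0) m (W i)) ξ
        = ∑ i, ∫ t in Set.Ioi (0 : ℝ), (t : ℂ) ^ (m + 1) * pd i (W i) (t • ξ) :=
          Finset.sum_congr rfl fun i _ => pd_radialIntegral (hW i) (hdom i) i hξ
      _ = ∫ t in Set.Ioi (0 : ℝ), (t : ℂ) ^ (m + 1) * F (t • ξ) := by
          rw [← integral_finsetSum _ fun i _ => integrableOn_radial (hW i) (hdom i) i hξ]
          simp_rw [← Finset.mul_sum, hdiv]
      _ = ∫ t in Set.Ioi (0 : ℝ), f ξ * ‖ξ‖ * (g (t * ‖ξ‖) : ℂ) := by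
          refine setIntegral_congr_fun measurableSet_Ioi fun t ht => ?_
          have ht0 : (t : ℂ) ≠ 0 := ofReal_ne_zero.2 (ne_of_gt ht)
          simp only [F]
          rw [hf.homog t ht ξ hξ, norm_smul, Real.norm_of_nonneg (le_of_lt ht), cpow_neg,
            cpow_natCast]
          push_cast
          field_simp
          ring
      _ = f ξ := by
          rw [integral_const_mul, integral_complex_ofReal, hgint, ofReal_inv, mul_assoc,
            mul_inv_cancel₀ (ofReal_ne_zero.2 hpos.ne'), mul_one]

end HomogeneousDivergence

section ClassicalSymbols

variable {n : ℕ} {χ : Euc n → ℝ} {a : ℂ} {σ : Euc n → ℂ} {σc : ℕ → Euc n → ℂ}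

theorem IsCutoff.contDiff_mul (hχ : IsCutoff χ) {f : Euc n → ℂ}
    (hf : ContDiffOn ℝ (⊤ : ℕ∞) f {(0 : Euc n)}ᶜ) :
    ContDiff ℝ (⊤ : ℕ∞) (fun ξ => (χ ξ : ℂ) * f ξ) := by
  rw [contDiff_iff_contDiffAt]
  intro ξ
  rcases eq_or_ne ξ 0 with rfl | hξ
  · obtain ⟨ε, hε, h⟩ := hχ.zero_near
    refine (contDiffAt_const (c := 0)).congr_of_eventuallyEq ?_
    filter_upwards [ball_mem_nhds (0 : Euc n) hε] with y hy
    simp [h y (mem_ball_zero_iff.1 hy)]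
  · exact (ofRealCLM.contDiff.comp hχ.smooth).contDiffAt.mul
      (hf.contDiffAt (isOpen_compl_singleton.mem_nhds hξ))

/-- The difference of a symbol and its first `K` cut-off homogeneous components. -/
def symbolRemainder (χ : Euc n → ℝ) (σ : Euc n → ℂ) (σc : ℕ → Euc n → ℂ) (K : ℕ) : Euc n → ℂ :=
  fun η => σ η - ∑ j ∈ Finset.range K, (χ η : ℂ) * σc j η

theorem symbolRemainder_eq (hχ : IsCutoff χ) {ξ : Euc n} (hξ : 1 < ‖ξ‖) (K : ℕ) :
    symbolRemainder χ σ σc K ξ = σ ξ - ∑ j ∈ Finset.range K, σc j ξ := by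
  simp [symbolRemainder, hχ.one_far ξ hξ.le]

theorem IsCS.isHomogeneousSmooth (hσ : IsCS χ a σ σc) (j : ℕ) :
    IsHomogeneousSmooth (a - j) (σc j) :=
  ⟨hσ.comp_smooth j, hσ.comp_homog j⟩

theorem IsCS.isSymbol_remainder (hχ : IsCutoff χ) (hσ : IsCS χ a σ σc) (K : ℕ) :
    IsSymbol (a.re - K) (symbolRemainder χ σ σc K) where
  smooth := hσ.smooth.sub (ContDiff.sum fun j _ => hχ.contDiff_mul (hσ.comp_smooth j))
  bound := hσ.estimate K

theorem sphInt_eq_zero_of_resCC_eq_zero (hres : resCC a σc = 0) {j : ℕ} (hj : a - j = -(n : ℂ)) :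
    sphInt (σc j) = 0 := by
  have h : ∃ j : ℕ, a - j = -(n : ℂ) := ⟨j, hj⟩
  have hchoose : h.choose = j := by
    have h2 := h.choose_spec.trans hj.symm
    exact_mod_cast sub_right_injective h2
  rw [resCC, dif_pos h, hchoose] at hres
  refine (mul_eq_zero.1 hres).resolve_left (ofReal_ne_zero.2 ?_)
  exact (Real.rpow_pos_of_pos (by positivity) _).ne'

/-- Every homogeneous component of a classical symbol with vanishing residue is the divergence
of a homogeneous vector field, which is radial except in degree `-n`. -/
theorem IsCS.exists_homogeneous_divergence (hn : 2 ≤ n) (hσ : IsCS χ a σ σc)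
    (hres : resCC a σc = 0) (j : ℕ) :
    ∃ V : Fin n → Euc n → ℂ, (∀ i, IsHomogeneousSmooth (a + 1 - j) (V i)) ∧
      (∀ ξ, ξ ≠ 0 → ∑ i, pd i (V i) ξ = σc j ξ) ∧
      (a - j ≠ -n → ∀ i ξ, V i ξ = ξ i * ((a - j + n)⁻¹ * σc j ξ)) := by
  have hj := hσ.isHomogeneousSmooth j
  by_cases h : a - j = -n
  · rw [h] at hj
    obtain ⟨V, hV, hdiv⟩ :=
      _root_.exists_homogeneous_divergence hn hj (sphInt_eq_zero_of_resCC_eq_zero hres h)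
    refine ⟨V, fun i => ?_, hdiv, fun h' => absurd h h'⟩
    have hdeg : a + 1 - j = 1 - n := by
      rw [add_sub_right_comm, h]
      ring
    rw [hdeg]
    exact hV i
  · refine ⟨fun i ξ => ξ i * ((a - j + n)⁻¹ * σc j ξ), fun i => ?_, fun ξ hξ => ?_,
      fun _ _ _ => rfl⟩
    · have hdeg : a + 1 - j = 1 + (a - j) := by ring
      rw [hdeg]
      exact (IsHomogeneousSmooth.coord i).mul (hj.const_mul _)
    · have h0 : a - j + n ≠ 0 := fun h0 => h (eq_neg_of_add_eq_zero_left h0)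
      rw [(hj.const_mul _).divergence_coord_mul hξ, mul_inv_cancel_left₀ h0]

theorem IsCS.sum_sub_coord_mul_radialIntegral_eq (hχ : IsCutoff χ) (hσ : IsCS χ a σ σc) {m : ℕ}
    (hmn : m + 1 = n) {i : Fin n} {V : ℕ → Euc n → ℂ}
    (hV : ∀ j : ℕ, a - j ≠ -n → ∀ ξ, V j ξ = ξ i * ((a - j + n)⁻¹ * σc j ξ)) {N₀ : ℕ}
    (hN₀ : a.re - N₀ < -n) {K : ℕ} (hK : N₀ ≤ K) {ξ : Euc n} (hξ : 1 < ‖ξ‖) :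
    ∑ j ∈ Finset.range N₀, V j ξ -
        ξ i * radialIntegral (Set.Ioi 1) m (symbolRemainder χ σ σc N₀) ξ =
      ∑ j ∈ Finset.range K, V j ξ -
        ξ i * radialIntegral (Set.Ioi 1) m (symbolRemainder χ σ σc K) ξ := by
  induction K, hK using Nat.le_induction with
  | base => rfl
  | succ K hK ih =>
    have hKr : a.re - K < -n := by
      have : (N₀ : ℝ) ≤ K := by exact_mod_cast hK
      linarith
    have hne : a - K ≠ -n := fun h => by
      have := congrArg re h
      simp at this
      linarith
    have h := IsSymbol.radialIntegral_sub_of_eq_homogeneous (hσ.isSymbol_remainder hχ K)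
      (hσ.isSymbol_remainder hχ (K + 1)) hmn hKr (by push_cast; linarith)
      (hσ.isHomogeneousSmooth K) (by simpa using hKr)
      (fun η hη => by
        rw [symbolRemainder_eq hχ hη, symbolRemainder_eq hχ hη, Finset.sum_range_succ]
        ring) hξ
    rw [ih, Finset.sum_range_succ, hV K hne ξ]
    linear_combination (-(ξ i : ℂ)) * h

end ClassicalSymbols

/-- A classical symbol of order `a` with vanishing residue is, up to a smoothing
symbol, a finite sum of partial derivatives of classical symbols of order `a + 1`. -/
theorem ker_res_sum_of_derivatives {n : ℕ} (hn : 2 ≤ n) {χ : Euc n → ℝ}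
    (hχ : IsCutoff χ) (a : ℂ) (σ : Euc n → ℂ) (σc : ℕ → Euc n → ℂ)
    (hσ : IsCS χ a σ σc) (hres : resCC a σc = 0) :
    ∃ (τ : Fin n → Euc n → ℂ) (τc : Fin n → ℕ → Euc n → ℂ),
      (∀ i, IsCS χ (a + 1) (τ i) (τc i)) ∧
      IsSmoothing (fun ξ => σ ξ - ∑ i, pd i (τ i) ξ) := by
  obtain ⟨m, hmn⟩ : ∃ m, m + 1 = n := ⟨n - 1, by omega⟩
  have hn0 : (0 : ℝ) ≤ n := Nat.cast_nonneg _
  have hmn' : (m : ℝ) + 1 = n := by exact_mod_cast hmn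
  choose V hV hVdiv hVrad using hσ.exists_homogeneous_divergence hn hres
  obtain ⟨N₀, hN₀⟩ := exists_nat_gt (a.re + n)
  have hN₀' : a.re - N₀ < -n := by linarith
  let ρ := symbolRemainder χ σ σc
  have hρ := hσ.isSymbol_remainder hχ
  let R : ℕ → Euc n → ℂ := fun K => radialIntegral (Set.Ioi 1) m (ρ K)
  have hR : ∀ K : ℕ, N₀ ≤ K → IsSymbolAtInfinity (a.re - K) (R K) := fun K hK => by
    have : (N₀ : ℝ) ≤ K := by exact_mod_cast hK
    exact (hρ K).isSymbolAtInfinity_radialIntegral (by linarith) (by linarith)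
  let u : Fin n → Euc n → ℂ := fun i ξ => ∑ j ∈ Finset.range N₀, V j i ξ - ξ i * R N₀ ξ
  have hcR : ∀ i, ContDiffOn ℝ (⊤ : ℕ∞) (fun ξ : Euc n => (ξ i : ℂ) * R N₀ ξ) {(0 : Euc n)}ᶜ :=
    fun i => (contDiff_coord i).contDiffOn.mul (hR N₀ le_rfl).smooth
  have hu : ∀ i, ContDiffOn ℝ (⊤ : ℕ∞) (u i) {(0 : Euc n)}ᶜ := fun i =>
    (ContDiffOn.sum fun j _ => (hV j i).smooth).sub (hcR i)
  have hτ : ∀ i, ContDiff ℝ (⊤ : ℕ∞) (fun ξ => (χ ξ : ℂ) * u i ξ) := fun i =>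
    hχ.contDiff_mul (hu i)
  refine ⟨fun i ξ => χ ξ * u i ξ, fun i j => V j i, fun i => ⟨hτ i, fun j => (hV j i).smooth,
    fun j => (hV j i).homog, fun N L => ?_⟩, ?_, fun L M _ => ?_⟩
  · have hsmooth : ContDiff ℝ (⊤ : ℕ∞)
        (fun ξ => (χ ξ : ℂ) * u i ξ - ∑ j ∈ Finset.range N, (χ ξ : ℂ) * V j i ξ) :=
      (hτ i).sub (ContDiff.sum fun j _ => hχ.contDiff_mul (hV j i).smooth)
    refine exists_pos_norm_pdIter_le hsmooth _ L ?_
    set K := max N N₀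
    have hNK : (N : ℝ) ≤ K := by exact_mod_cast le_max_left N N₀
    have hsym : IsSymbolAtInfinity ((a + 1).re - N)
        (fun ξ => ∑ j ∈ Finset.Ico N K, V j i ξ + (-1 * (ξ i : ℂ)) * R K ξ) := by
      refine (IsSymbolAtInfinity.sum _ fun j hj => (hV j i).isSymbolAtInfinity.mono ?_).add
        ((((IsHomogeneousSmooth.coord i).const_mul (-1)).isSymbolAtInfinity.mul
          (hR K (le_max_right _ _))).mono ?_)
      · have : (N : ℝ) ≤ j := by exact_mod_cast (Finset.mem_Ico.1 hj).1
        simp only [sub_re, natCast_re]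
        linarith
      · simp only [add_re, one_re]
        linarith
    obtain ⟨C, hC⟩ := hsym.bound L
    refine ⟨C, fun ξ hξ => ?_⟩
    rw [pdIter_congr isOpen_one_lt_norm (fun η hη => ?_) L hξ]
    · exact hC ξ hξ
    · have h1 := hσ.sum_sub_coord_mul_radialIntegral_eq hχ hmn (fun j hj => hVrad j hj i) hN₀'
        (le_max_right N N₀) hη
      have h2 := Finset.sum_range_add_sum_Ico (fun j => V j i η) (le_max_left N N₀)
      simp only [hχ.one_far η (le_of_lt hη), ofReal_one, one_mul, u]
      linear_combination h1 - h2
  · exact hσ.smooth.sub (ContDiff.sum fun i _ => contDiff_pd (hτ i) i)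
  · refine exists_pos_norm_pdIter_le
      (hσ.smooth.sub (ContDiff.sum fun i _ => contDiff_pd (hτ i) i)) _ L ⟨0, fun ξ hξ => ?_⟩
    rw [pdIter_congr (g := fun _ => 0) isOpen_one_lt_norm (fun η hη => ?_) L hξ]
    · simp [pdIter_zero]
    · have hη0 := ne_zero_of_one_lt_norm hη
      have hpd : ∀ i, pd i (fun ξ => (χ ξ : ℂ) * u i ξ) η =
          ∑ j ∈ Finset.range N₀, pd i (V j i) η - pd i (fun ξ => (ξ i : ℂ) * R N₀ ξ) η := by
        intro i
        rw [pd_congr isOpen_one_lt_norm (g := u i)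
          (fun ζ hζ => by simp [hχ.one_far ζ (le_of_lt hζ)]) i hη,
          pd_sub (differentiableAt_of_contDiffOn isOpen_compl_singleton
            (ContDiffOn.sum fun j _ => (hV j i).smooth) hη0)
            (differentiableAt_of_contDiffOn isOpen_compl_singleton (hcR i) hη0),
          pd_sum _ fun j _ => (hV j i).differentiableAt hη0]
      simp only
      simp_rw [hpd]
      rw [Finset.sum_sub_distrib, Finset.sum_comm,
        (hρ N₀).divergence_coord_mul_radialIntegral hmn hN₀' hη0, symbolRemainder_eq hχ hη,
        Finset.sum_congr rfl fun j _ => hVdiv j η hη0]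
      ring

end
end
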